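/- arXiv:2411.14083 — 2 statements merged into one kernel-verified Lean document; each statement's English description precedes it below -/
import Mathlib

section
/- Let K : ℕ₀×ℕ₀ → [0,∞) be a symmetric kernel satisfying K_{j,k} ≤ C_q (j^μ k^ν + j^ν k^μ) for all j,k ∈ ℕ₀ with μ, ν ∈ [0,2], μ + ν ≤ 3 and C_q > 0, and let f(0) ∈ Y_λ^+ where λ := max{μ,ν} if max{μ,ν} > 1 and λ := 1 otherwise. Then the EDG system admits a global solution f = (f_j)_{j≥0} with f(t) ∈ Y_λ^+ whose components are continuously differentiable on [0,∞), which satisfies the EDG differential equations pointwise, and which conserves the number of particles and the total mass: M_0(f(t)) = M_0(f(0)) and M_1(f(t)) = M_1(f(0)) for all t ≥ 0. -/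
open MeasureTheory Filter

noncomputable section

/-- Membership in the positive cone `Y_r^+`: componentwise nonnegative sequences with
`∑ j^r f_j < ∞`. -/
def MemYplus (r : ℝ) (g : ℕ → ℝ) : Prop :=
  (∀ j, 0 ≤ g j) ∧ Summable (fun j : ℕ => (j : ℝ) ^ r * g j)

/-- The `p`-th moment `M_p(g) = ∑_{j=0}^∞ j^p g_j`. -/
def mom (p : ℝ) (g : ℕ → ℝ) : ℝ := ∑' j : ℕ, (j : ℝ) ^ p * g j

/-- Right-hand side of the infinite EDG system. -/
def edgRHS (K : ℕ → ℕ → ℝ) (g : ℕ → ℝ) : ℕ → ℝ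
  | 0 => g 1 * (∑' k : ℕ, K 1 k * g k) - g 0 * (∑' k : ℕ, K (k + 1) 0 * g (k + 1))
  | m + 1 =>
      g (m + 2) * (∑' k : ℕ, K (m + 2) k * g k) - g (m + 1) * (∑' k : ℕ, K (m + 1) k * g k)
        - g (m + 1) * (∑' k : ℕ, K (k + 1) (m + 1) * g (k + 1))
        + g m * (∑' k : ℕ, K (k + 1) m * g (k + 1))

/-- Mild solution of the EDG system on a time set `S` (containing `0`), with values in
`Y_r^+`. -/
def IsMildSolutionOn (K : ℕ → ℕ → ℝ) (r : ℝ) (f : ℝ → ℕ → ℝ) (S : Set ℝ) : Prop :=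
  (∀ t ∈ S, MemYplus r (f t)) ∧
  (∀ j : ℕ, ContinuousOn (fun t => f t j) S) ∧
  (∃ B : ℝ, ∀ t ∈ S, (∑' j : ℕ, (j : ℝ) ^ r * f t j) ≤ B) ∧
  (∀ t ∈ S, ∀ j : ℕ, Summable (fun k : ℕ => K j k * f t k)) ∧
  (∀ t ∈ S, ∀ j : ℕ,
    MeasureTheory.IntegrableOn (fun s => ∑' k : ℕ, K j k * f s k) (Set.Icc 0 t)) ∧
  (∀ t ∈ S, f t 0 = f 0 0 + ∫ s in (0:ℝ)..t,
      (f s 1 * (∑' k : ℕ, K 1 k * f s k) - f s 0 * (∑' k : ℕ, K (k + 1) 0 * f s (k + 1)))) ∧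
  (∀ t ∈ S, ∀ m : ℕ, f t (m + 1) = f 0 (m + 1) + ∫ s in (0:ℝ)..t,
      (f s (m + 2) * (∑' k : ℕ, K (m + 2) k * f s k)
        - f s (m + 1) * (∑' k : ℕ, K (m + 1) k * f s k)
        - f s (m + 1) * (∑' k : ℕ, K (k + 1) (m + 1) * f s (k + 1))
        + f s m * (∑' k : ℕ, K (k + 1) m * f s (k + 1))))

/-- Classical (continuously differentiable) solution of the EDG system on a time set `S`. -/
def IsClassicalSolutionOn (K : ℕ → ℕ → ℝ) (f : ℝ → ℕ → ℝ) (S : Set ℝ) : Prop :=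
  (∀ t ∈ S, ∀ j : ℕ, Summable (fun k : ℕ => K j k * f t k) ∧
      Summable (fun k : ℕ => K (k + 1) j * f t (k + 1))) ∧
  (∀ t ∈ S, ∀ j : ℕ, HasDerivWithinAt (fun s => f s j) (edgRHS K (f t) j) S t) ∧
  (∀ j : ℕ, ContinuousOn (fun t => edgRHS K (f t) j) S)

/-- Right-hand side of the truncated EDG system with `N+1` equations. -/
def truncRHS (K : ℕ → ℕ → ℝ) (N : ℕ) (g : ℕ → ℝ) (j : ℕ) : ℝ :=
  if j = 0 then
    g 1 * (∑ k ∈ Finset.range N, K 1 k * g k) - g 0 * (∑ k ∈ Finset.Icc 1 N, K k 0 * g k)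
  else if j = N then
    - g N * (∑ k ∈ Finset.range N, K N k * g k)
      + g (N - 1) * (∑ k ∈ Finset.Icc 1 N, K k (N - 1) * g k)
  else
    g (j + 1) * (∑ k ∈ Finset.range N, K (j + 1) k * g k)
      - g j * (∑ k ∈ Finset.range N, K j k * g k)
      - g j * (∑ k ∈ Finset.Icc 1 N, K k j * g k)
      + g (j - 1) * (∑ k ∈ Finset.Icc 1 N, K k (j - 1) * g k)

/-- `fN` is a (global, `C¹`) solution of the truncated EDG system of size `N`. -/
def IsTruncSolution (K : ℕ → ℕ → ℝ) (N : ℕ) (fN : ℝ → ℕ → ℝ) : Prop :=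
  ∀ t : ℝ, ∀ j ≤ N, HasDerivAt (fun s => fN s j) (truncRHS K N (fN t) j) t

/-- The gelation time `T_gel = inf { t ≥ 0 : ∑ j f_j(t) < ∑ j f_j(0) }`. -/
def gelTime (f : ℝ → ℕ → ℝ) : ℝ :=
  sInf { t : ℝ | 0 ≤ t ∧ (∑' j : ℕ, (j : ℝ) * f t j) < ∑' j : ℕ, (j : ℝ) * f 0 j }

/-- The class `𝒢_{1,∞}`: a nonnegative convex `C²` function `G` on `[0,∞)` with derivative
`G'`, such that `G(0) = G'(0) = 0`, `G'` is concave and positive on `(0,∞)`, and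
`G'(x) → ∞`, `G(x)/x → ∞` as `x → ∞`. -/
structure G1Inf where
  G : ℝ → ℝ
  G' : ℝ → ℝ
  hasDeriv : ∀ x ∈ Set.Ici (0:ℝ), HasDerivWithinAt G (G' x) (Set.Ici 0) x
  contDiff : ContDiffOn ℝ 2 G (Set.Ici 0)
  nonneg : ∀ x ∈ Set.Ici (0:ℝ), 0 ≤ G x
  convex : ConvexOn ℝ (Set.Ici 0) G
  zero : G 0 = 0
  deriv_zero : G' 0 = 0
  concave_deriv : ConcaveOn ℝ (Set.Ici 0) G'
  deriv_pos : ∀ x : ℝ, 0 < x → 0 < G' x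
  tendsto_deriv : Filter.Tendsto G' Filter.atTop Filter.atTop
  tendsto_div : Filter.Tendsto (fun x => G x / x) Filter.atTop Filter.atTop

end

/-- The convex weight `k ^ r` damped below level `n` by the concave factor `min 1 (k / n)`. -/
noncomputable def dampedWeight (r : ℝ) (n k : ℕ) : ℝ := (k : ℝ) ^ r * min 1 ((k : ℝ) / n)

lemma dampedWeight_nonneg (r : ℝ) (n k : ℕ) : 0 ≤ dampedWeight r n k := by
  unfold dampedWeight; positivity

lemma dampedWeight_zero (r : ℝ) (n : ℕ) : dampedWeight r n 0 = 0 := by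
  simp [dampedWeight]

lemma dampedWeight_le (r : ℝ) (n k : ℕ) : dampedWeight r n k ≤ (k : ℝ) ^ r :=
  mul_le_of_le_one_right (by positivity) (min_le_left _ _)

lemma one_add_rpow_le {r s : ℝ} (h1 : 1 ≤ r) (h2 : r ≤ 2) (hs : -1 ≤ s) :
    (1 + s) ^ r ≤ 1 + r * s + r / 2 * s ^ 2 := by
  have h0 : 0 ≤ 1 + s := by linarith
  have e : (1 + s) ^ r = (1 + (2 * s + s ^ 2)) ^ (r / 2) := by
    rw [show 1 + (2 * s + s ^ 2) = (1 + s) ^ (2 : ℝ) by rw [Real.rpow_two]; ring,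
      ← Real.rpow_mul h0]
    ring_nf
  have := rpow_one_add_le_one_add_mul_self (s := 2 * s + s ^ 2) (p := r / 2)
    (by nlinarith [sq_nonneg (1 + s)]) (by linarith) (by linarith)
  rw [e]; linarith

lemma succ_rpow_eq {r x : ℝ} (hx : 0 < x) : (x + 1) ^ r = x ^ r * (1 + 1 / x) ^ r := by
  rw [← Real.mul_rpow hx.le (by positivity)]
  congr 1; field_simp

lemma pred_rpow_eq {r x : ℝ} (hx : 1 ≤ x) : (x - 1) ^ r = x ^ r * (1 + -(1 / x)) ^ r := by
  have h0 : 0 < x := by linarith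
  have : 1 / x ≤ 1 := by rw [div_le_one h0]; exact hx
  rw [← Real.mul_rpow h0.le (by linarith)]
  congr 1; field_simp; ring

lemma product_second_diff_le {r s p q θ a b : ℝ} (h2 : r ≤ 2) (hs0 : 0 ≤ s)
    (hs1 : s ≤ 1) (b1 : p ≤ 1 + r * s + r / 2 * s ^ 2) (b2 : q ≤ 1 + r * -s + r / 2 * (-s) ^ 2)
    (b3 : 1 + r * -s ≤ q) (b4 : 0 ≤ q) (c4 : 1 + r * s ≤ p) (c5 : q ≤ 1) (hθ0 : 0 ≤ θ)
    (c1 : a - θ ≤ θ - b) (c2 : a - θ ≤ s * θ) (c3 : 0 ≤ a - θ) :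
    p * a - 2 * θ + q * b ≤ 7 * (s ^ 2 * θ) := by
  have d1 : p - 2 + q ≤ 2 * s ^ 2 := by nlinarith [sq_nonneg s]
  have d2 : p - q ≤ 5 * s := by nlinarith [sq_nonneg s]
  have d3 : 0 ≤ p - q := by nlinarith
  have k1 : (p - 2 + q) * θ ≤ 2 * s ^ 2 * θ := mul_le_mul_of_nonneg_right d1 hθ0
  have k2 : (p - q) * (a - θ) ≤ 5 * s * (s * θ) := mul_le_mul d2 c2 c3 (by positivity)
  have k3 : q * (a - θ) ≤ q * (θ - b) := mul_le_mul_of_nonneg_left c1 b4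
  linarith

/-- Second difference of the damped weight. -/
lemma dampedWeight_second_diff_le {r : ℝ} (h1 : 1 ≤ r) (h2 : r ≤ 2) (n j : ℕ) :
    dampedWeight r n (j + 2) - 2 * dampedWeight r n (j + 1) + dampedWeight r n j
      ≤ 7 * (((j + 1 : ℕ) : ℝ) ^ (r - 2) * min 1 (((j + 1 : ℕ) : ℝ) / n)) := by
  unfold dampedWeight
  set x : ℝ := ((j + 1 : ℕ) : ℝ) with hx
  have hx1 : 1 ≤ x := by rw [hx]; push_cast; linarith [Nat.cast_nonneg (α := ℝ) j]
  have hx0 : 0 < x := by linarith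
  have e2 : ((j + 2 : ℕ) : ℝ) = x + 1 := by rw [hx]; push_cast; ring
  have e0 : (j : ℝ) = x - 1 := by rw [hx]; push_cast; ring
  rw [e2, e0]
  set s := 1 / x with hs
  have hs0 : 0 < s := by positivity
  have hs1 : s ≤ 1 := by rw [hs, div_le_one hx0]; exact hx1
  have hxs : x * s = 1 := by rw [hs]; field_simp
  rw [succ_rpow_eq hx0, pred_rpow_eq hx1, ← hs]
  set u := x ^ r with hu
  have hu0 : 0 < u := by positivity
  have er : x ^ (r - 2) = u * s ^ 2 := by
    rw [Real.rpow_sub hx0, Real.rpow_two, hs, hu]; ring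
  rw [er]
  have b1 := one_add_rpow_le h1 h2 (s := s) (by linarith)
  have b2 := one_add_rpow_le h1 h2 (s := -s) (by linarith)
  have b3 : 1 + r * (-s) ≤ (1 + -s) ^ r := one_add_mul_self_le_rpow_one_add (by linarith) h1
  have b4 : 0 ≤ (1 + -s) ^ r := Real.rpow_nonneg (by linarith) _
  set p := (1 + s) ^ r
  set q := (1 + -s) ^ r
  set θ := min 1 (x / n)
  set a := min 1 ((x + 1) / n)
  set b := min 1 ((x - 1) / n)
  have hn : (0 : ℝ) ≤ n := Nat.cast_nonneg n
  have i1 : x / n ≤ (x + 1) / n := by gcongr; linarith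
  have i2 : (x - 1) / n ≤ x / n := by gcongr; linarith
  have i3 : (x - 1) / n + (x + 1) / n = 2 * (x / n) := by ring
  have i4 : (x + 1) / n = (1 + s) * (x / n) := by
    rw [← mul_div_assoc, add_mul, one_mul, mul_comm s, hxs]
  have i5 : 0 ≤ x / n := by positivity
  have hθ0 : 0 ≤ θ := by positivity
  have c1 : a - θ ≤ θ - b := by
    simp only [a, b, θ]
    rcases min_cases 1 (x / n) with h | h <;> rcases min_cases 1 ((x + 1) / n) with h' | h' <;>
      rcases min_cases 1 ((x - 1) / n) with h'' | h'' <;> linarith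
  have c2 : a - θ ≤ s * θ := by
    simp only [a, θ]
    rcases min_cases 1 (x / n) with h | h <;> rcases min_cases 1 ((x + 1) / n) with h' | h' <;>
      nlinarith
  have c3 : 0 ≤ a - θ := by
    simp only [a, θ]
    rcases min_cases 1 (x / n) with h | h <;> rcases min_cases 1 ((x + 1) / n) with h' | h' <;>
      linarith
  have c4 : 1 + r * s ≤ p := one_add_mul_self_le_rpow_one_add (by linarith) h1
  have c5 : q ≤ 1 := Real.rpow_le_one (by linarith) (by linarith) (by linarith)
  have key := product_second_diff_le h2 hs0.le hs1 b1 b2 b3 b4 c4 c5 hθ0 c1 c2 c3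
  calc u * p * a - 2 * (u * θ) + u * q * b = u * (p * a - 2 * θ + q * b) := by ring
    _ ≤ u * (7 * (s ^ 2 * θ)) := by gcongr
    _ = 7 * (u * s ^ 2 * θ) := by ring

lemma dampedWeight_one_le_diff {r : ℝ} (h1 : 1 ≤ r) (n j : ℕ) :
    dampedWeight r n 1 ≤ dampedWeight r n (j + 1) - dampedWeight r n j := by
  unfold dampedWeight
  have hj : (0 : ℝ) ≤ j := Nat.cast_nonneg j
  have a1 : min (1 : ℝ) (((1 : ℕ) : ℝ) / n) ≤ min 1 (((j + 1 : ℕ) : ℝ) / n) := by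
    gcongr; omega
  have a2 : min (1 : ℝ) ((j : ℝ) / n) ≤ min 1 (((j + 1 : ℕ) : ℝ) / n) := by
    gcongr; omega
  have a3 : (j : ℝ) ^ r + 1 ≤ ((j + 1 : ℕ) : ℝ) ^ r := by
    have := Real.add_rpow_le_rpow_add hj zero_le_one h1
    simpa using this
  have a4 : (0 : ℝ) ≤ (j : ℝ) ^ r := by positivity
  have a5 : (0 : ℝ) ≤ min 1 (((j + 1 : ℕ) : ℝ) / n) := by positivity
  simp only [Nat.cast_one, Real.one_rpow, one_mul] at *
  nlinarith [mul_le_mul_of_nonneg_right a3 a5, mul_le_mul_of_nonneg_left a2 a4]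

lemma rpow_mul_rpow_le_of_le {r a b x y : ℝ} (hx : 1 ≤ x) (hxy : x ≤ y)
    (hb : b ≤ r) (hab : a + b ≤ r + 1) : x ^ a * y ^ b ≤ x * y ^ r := by
  have hx0 : 0 < x := by linarith
  have hy1 : 1 ≤ y := hx.trans hxy
  have hy0 : 0 < y := by linarith
  rcases le_total a 1 with h | h
  · have := Real.rpow_le_rpow_of_exponent_le hx h
    rw [Real.rpow_one] at this
    gcongr
  · calc x ^ a * y ^ b = x * (x ^ (a - 1) * y ^ b) := by
          rw [Real.rpow_sub_one hx0.ne']; field_simp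
      _ ≤ x * (y ^ (a - 1) * y ^ b) := by
          gcongr
      _ = x * y ^ (a - 1 + b) := by rw [Real.rpow_add hy0]
      _ ≤ x * y ^ r := by
          gcongr
          linarith

/-- Redistribution of a mixed monomial onto the damped weight and the mass. -/
lemma rpow_mul_rpow_mul_min_le {r a b : ℝ} (ha : a ≤ r) (hb : b ≤ r) (hab : a + b ≤ r + 1)
    (n : ℕ) {j k : ℕ} (hj : 1 ≤ j) (hk : 1 ≤ k) :
    (j : ℝ) ^ a * (k : ℝ) ^ b * min 1 ((j : ℝ) / n)
      ≤ dampedWeight r n j * k + dampedWeight r n k * j := by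
  have hj' : (1 : ℝ) ≤ j := by exact_mod_cast hj
  have hk' : (1 : ℝ) ≤ k := by exact_mod_cast hk
  have p1 := dampedWeight_nonneg r n j
  have p2 := dampedWeight_nonneg r n k
  rcases le_total j k with h | h
  · have h' : (j : ℝ) ≤ k := by exact_mod_cast h
    have := rpow_mul_rpow_le_of_le hj' h' hb hab
    calc _ ≤ ((j : ℝ) * (k : ℝ) ^ r) * min 1 ((k : ℝ) / n) := by gcongr
      _ = dampedWeight r n k * j := by unfold dampedWeight; ring
      _ ≤ _ := le_add_of_nonneg_left (by positivity)
  · have h' : (k : ℝ) ≤ j := by exact_mod_cast h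
    have := rpow_mul_rpow_le_of_le hk' h' ha (by linarith : b + a ≤ r + 1)
    calc _ = ((k : ℝ) ^ b * (j : ℝ) ^ a) * min 1 ((j : ℝ) / n) := by ring
      _ ≤ ((k : ℝ) * (j : ℝ) ^ r) * min 1 ((j : ℝ) / n) := by gcongr
      _ = dampedWeight r n j * k := by unfold dampedWeight; ring
      _ ≤ _ := le_add_of_nonneg_right (by positivity)

lemma kernel_mul_second_diff_le {K : ℕ → ℕ → ℝ} {Cq μ ν r : ℝ}
    (hKnn : ∀ j k : ℕ, 0 ≤ K j k) (hCq : 0 < Cq)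
    (hμ2 : μ ≤ 2) (hν2 : ν ≤ 2) (hμν : μ + ν ≤ 3)
    (hKle : ∀ j k : ℕ, K j k ≤ Cq * ((j : ℝ) ^ μ * (k : ℝ) ^ ν + (j : ℝ) ^ ν * (k : ℝ) ^ μ))
    (h1 : 1 ≤ r) (h2 : r ≤ 2) (hμr : μ ≤ r) (hνr : ν ≤ r) (n j : ℕ) {k : ℕ} (hk : 1 ≤ k) :
    K (j + 1) k * (dampedWeight r n (j + 2) - 2 * dampedWeight r n (j + 1) + dampedWeight r n j)
      ≤ 14 * Cq * (dampedWeight r n (j + 1) * k + dampedWeight r n k * (j + 1 : ℕ)) := by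
  have hx : (0 : ℝ) < ((j + 1 : ℕ) : ℝ) := by positivity
  set θ := min 1 (((j + 1 : ℕ) : ℝ) / n) with hθ
  have m1 := rpow_mul_rpow_mul_min_le (r := r) (a := μ + r - 2) (b := ν) (by linarith) hνr
    (by linarith) n (Nat.le_add_left 1 j) hk
  have m2 := rpow_mul_rpow_mul_min_le (r := r) (a := ν + r - 2) (b := μ) (by linarith) hμr
    (by linarith) n (Nat.le_add_left 1 j) hk
  have e1 : ((j + 1 : ℕ) : ℝ) ^ (μ + r - 2)
      = ((j + 1 : ℕ) : ℝ) ^ μ * ((j + 1 : ℕ) : ℝ) ^ (r - 2) := by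
    rw [← Real.rpow_add hx]; ring_nf
  have e2 : ((j + 1 : ℕ) : ℝ) ^ (ν + r - 2)
      = ((j + 1 : ℕ) : ℝ) ^ ν * ((j + 1 : ℕ) : ℝ) ^ (r - 2) := by
    rw [← Real.rpow_add hx]; ring_nf
  calc _ ≤ K (j + 1) k * (7 * (((j + 1 : ℕ) : ℝ) ^ (r - 2) * θ)) :=
        mul_le_mul_of_nonneg_left (dampedWeight_second_diff_le h1 h2 n j) (hKnn _ _)
    _ ≤ Cq * (((j + 1 : ℕ) : ℝ) ^ μ * (k : ℝ) ^ ν + ((j + 1 : ℕ) : ℝ) ^ ν * (k : ℝ) ^ μ)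
          * (7 * (((j + 1 : ℕ) : ℝ) ^ (r - 2) * θ)) := by
        gcongr
        exact hKle _ _
    _ = 7 * Cq * (((j + 1 : ℕ) : ℝ) ^ (μ + r - 2) * (k : ℝ) ^ ν * θ
          + ((j + 1 : ℕ) : ℝ) ^ (ν + r - 2) * (k : ℝ) ^ μ * θ) := by
        rw [e1, e2]; ring
    _ ≤ 7 * Cq * ((dampedWeight r n (j + 1) * k + dampedWeight r n k * (j + 1 : ℕ))
          + (dampedWeight r n (j + 1) * k + dampedWeight r n k * (j + 1 : ℕ))) := by
        gcongr
    _ = _ := by ring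

/-- Change of the number of `i`-clusters when a particle hops from a cluster of size `j + 1` to one
of size `k`. -/
noncomputable def jump (i j k : ℕ) : ℝ :=
  (if i = j then 1 else 0) - (if i = j + 1 then 1 else 0) + (if i = k + 1 then 1 else 0)
    - (if i = k then 1 else 0)

/-- Right-hand side of the EDG system with the kernel cut off to sizes at most `N`. -/
noncomputable def flux (K : ℕ → ℕ → ℝ) (N : ℕ) (x : ℕ → ℝ) (i : ℕ) : ℝ :=
  ∑ j ∈ Finset.range N, ∑ k ∈ Finset.range (N + 1), K (j + 1) k * x (j + 1) * x k * jump i j k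

lemma abs_jump_le (i j k : ℕ) : |jump i j k| ≤ 4 := by
  unfold jump
  split_ifs <;> norm_num

lemma hasSum_mul_jump (φ : ℕ → ℝ) (j k : ℕ) :
    HasSum (fun i => φ i * jump i j k) (φ j - φ (j + 1) + φ (k + 1) - φ k) := by
  have h (l : ℕ) : HasSum (fun i => φ i * (if i = l then (1 : ℝ) else 0)) (φ l) := by
    simpa using hasSum_ite_eq l (φ l) |>.congr_fun fun i => by
      by_cases hi : i = l <;> simp [hi]
  simpa only [jump, mul_sub, mul_add] using (((h j).sub (h (j + 1))).add (h (k + 1))).sub (h k)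

/-- Weak form of the truncated EDG system. -/
lemma hasSum_mul_flux (K : ℕ → ℕ → ℝ) (N : ℕ) (x φ : ℕ → ℝ) :
    HasSum (fun i => φ i * flux K N x i)
      (∑ j ∈ Finset.range N, ∑ k ∈ Finset.range (N + 1),
        K (j + 1) k * x (j + 1) * x k * (φ j - φ (j + 1) + φ (k + 1) - φ k)) := by
  have h := hasSum_sum (s := Finset.range N) fun j _ =>
    hasSum_sum (s := Finset.range (N + 1)) fun k _ =>
      (hasSum_mul_jump φ j k).mul_left (K (j + 1) k * x (j + 1) * x k)
  refine h.congr_fun fun i => ?_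
  simp only [flux, Finset.mul_sum]
  exact Finset.sum_congr rfl fun j _ => Finset.sum_congr rfl fun k _ => by ring

lemma hasSum_flux (K : ℕ → ℕ → ℝ) (N : ℕ) (x : ℕ → ℝ) : HasSum (flux K N x) 0 := by
  simpa using hasSum_mul_flux K N x 1

lemma hasSum_nat_mul_flux (K : ℕ → ℕ → ℝ) (N : ℕ) (x : ℕ → ℝ) :
    HasSum (fun i : ℕ => (i : ℝ) * flux K N x i) 0 := by
  simpa using hasSum_mul_flux K N x (fun i : ℕ => (i : ℝ))

lemma sum_range_succ_le_tsum {g : ℕ → ℝ} (h0 : ∀ k, 0 ≤ g k) (hg : Summable g) (N : ℕ) :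
    ∑ j ∈ Finset.range N, g (j + 1) ≤ ∑' k, g k := by
  have := hg.sum_le_tsum (Finset.range (N + 1)) fun i _ => h0 i
  rw [Finset.sum_range_succ'] at this
  linarith [h0 0]

lemma sum_mul_flux_le {K : ℕ → ℕ → ℝ} (hKnn : ∀ j k : ℕ, 0 ≤ K j k)
    (hKsym : ∀ j k : ℕ, K j k = K k j) {φ x : ℕ → ℝ} {C : ℝ} (hC : 0 ≤ C) (hx : ∀ j, 0 ≤ x j)
    (hφ : ∀ j, 0 ≤ φ j) (hφ0 : φ 0 = 0) (hconv : ∀ j, φ 1 ≤ φ (j + 1) - φ j)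
    (hdrift : ∀ j k, 1 ≤ k → K (j + 1) k * (φ (j + 2) - 2 * φ (j + 1) + φ j)
      ≤ C * (φ (j + 1) * k + φ k * (j + 1 : ℕ)))
    (h1 : Summable fun k : ℕ => (k : ℝ) * x k) (h2 : Summable fun k => φ k * x k) (N : ℕ) :
    ∑ j ∈ Finset.range N, ∑ k ∈ Finset.range (N + 1),
        K (j + 1) k * x (j + 1) * x k * (φ j - φ (j + 1) + φ (k + 1) - φ k)
      ≤ 2 * C * (∑' k : ℕ, (k : ℝ) * x k) * ∑' k, φ k * x k := by
  set R := Finset.range N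
  have swap : ∑ j ∈ R, ∑ k ∈ R, K (j + 1) (k + 1) * x (j + 1) * x (k + 1) * (φ (k + 2) - φ (k + 1))
      = ∑ j ∈ R, ∑ k ∈ R,
        K (j + 1) (k + 1) * x (j + 1) * x (k + 1) * (φ (j + 2) - φ (j + 1)) := by
    rw [Finset.sum_comm]
    refine Finset.sum_congr rfl fun j _ => Finset.sum_congr rfl fun k _ => ?_
    rw [hKsym]; ring
  have s1 : ∑ j ∈ R, φ (j + 1) * x (j + 1) ≤ ∑' k, φ k * x k :=
    sum_range_succ_le_tsum (fun k => mul_nonneg (hφ k) (hx k)) h2 N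
  have s2 : ∑ k ∈ R, ((k + 1 : ℕ) : ℝ) * x (k + 1) ≤ ∑' k : ℕ, (k : ℝ) * x k :=
    sum_range_succ_le_tsum (g := fun k : ℕ => (k : ℝ) * x k)
      (fun k => mul_nonneg k.cast_nonneg (hx k)) h1 N
  have s0 : 0 ≤ ∑ k ∈ R, ((k + 1 : ℕ) : ℝ) * x (k + 1) :=
    Finset.sum_nonneg fun k _ => mul_nonneg (Nat.cast_nonneg _) (hx _)
  calc _ ≤ ∑ j ∈ R, ∑ k ∈ R, K (j + 1) (k + 1) * x (j + 1) * x (k + 1)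
            * (φ j - φ (j + 1) + φ (k + 2) - φ (k + 1)) := by
        refine Finset.sum_le_sum fun j _ => ?_
        rw [Finset.sum_range_succ', hφ0]
        have : K (j + 1) 0 * x (j + 1) * x 0 * (φ j - φ (j + 1) + φ (0 + 1) - 0) ≤ 0 :=
          mul_nonpos_of_nonneg_of_nonpos
            (mul_nonneg (mul_nonneg (hKnn _ _) (hx _)) (hx _)) (by
              have := hconv j
              simp only [zero_add]
              linarith)
        exact add_le_of_nonpos_right this
    _ = ∑ j ∈ R, ∑ k ∈ R, x (j + 1) * x (k + 1)
          * (K (j + 1) (k + 1) * (φ (j + 2) - 2 * φ (j + 1) + φ j)) := by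
        have e : ∀ j k, K (j + 1) (k + 1) * x (j + 1) * x (k + 1)
            * (φ j - φ (j + 1) + φ (k + 2) - φ (k + 1))
            = K (j + 1) (k + 1) * x (j + 1) * x (k + 1) * (φ j - φ (j + 1))
              + K (j + 1) (k + 1) * x (j + 1) * x (k + 1) * (φ (k + 2) - φ (k + 1)) :=
          fun j k => by ring
        simp only [e, Finset.sum_add_distrib, swap]
        simp only [← Finset.sum_add_distrib]
        exact Finset.sum_congr rfl fun j _ => Finset.sum_congr rfl fun k _ => by ring
    _ ≤ ∑ j ∈ R, ∑ k ∈ R, x (j + 1) * x (k + 1)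
          * (C * (φ (j + 1) * (k + 1 : ℕ) + φ (k + 1) * (j + 1 : ℕ))) :=
        Finset.sum_le_sum fun j _ => Finset.sum_le_sum fun k _ =>
          mul_le_mul_of_nonneg_left (hdrift j (k + 1) (by omega)) (mul_nonneg (hx _) (hx _))
    _ = 2 * C * (∑ k ∈ R, ((k + 1 : ℕ) : ℝ) * x (k + 1)) * ∑ j ∈ R, φ (j + 1) * x (j + 1) := by
        have e : ∀ j k, x (j + 1) * x (k + 1)
            * (C * (φ (j + 1) * (k + 1 : ℕ) + φ (k + 1) * (j + 1 : ℕ)))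
            = C * ((φ (j + 1) * x (j + 1)) * (((k + 1 : ℕ) : ℝ) * x (k + 1)))
              + C * ((((j + 1 : ℕ) : ℝ) * x (j + 1)) * (φ (k + 1) * x (k + 1))) :=
          fun j k => by ring
        simp only [e, Finset.sum_add_distrib, ← Finset.mul_sum, ← Finset.sum_mul]
        ring
    _ ≤ _ := by
        have := s0.trans s2
        have := Finset.sum_nonneg fun j (_ : j ∈ R) => mul_nonneg (hφ (j + 1)) (hx (j + 1))
        gcongr

lemma abs_flux_sub_le {K : ℕ → ℕ → ℝ} {W x y : ℕ → ℝ} {c : ℝ} (hKnn : ∀ j k : ℕ, 0 ≤ K j k)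
    (hc : 0 ≤ c) (hW : ∀ k, 0 ≤ W k) (hK : ∀ j k, K j k ≤ c * (W j * W k))
    (hx : ∀ k, 0 ≤ x k) (hy : ∀ k, 0 ≤ y k) (hxs : Summable fun k => W k * x k)
    (hys : Summable fun k => W k * y k) (N i : ℕ) :
    |flux K N x i - flux K N y i|
      ≤ 4 * c * ((∑' k, W k * x k) + ∑' k, W k * y k) * ∑' k, W k * |x k - y k| := by
  have hds : Summable fun k => W k * |x k - y k| := by
    refine Summable.of_nonneg_of_le (fun k => mul_nonneg (hW k) (abs_nonneg _)) (fun k => ?_)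
      (hxs.add hys)
    rw [← mul_add]
    exact mul_le_mul_of_nonneg_left (abs_le.2 ⟨by linarith [hx k, hy k], by linarith [hx k, hy k]⟩)
      (hW k)
  have d0 : ∀ k, 0 ≤ W k * |x k - y k| := fun k => mul_nonneg (hW k) (abs_nonneg _)
  have x0 : ∀ k, 0 ≤ W k * x k := fun k => mul_nonneg (hW k) (hx k)
  have y0 : ∀ k, 0 ≤ W k * y k := fun k => mul_nonneg (hW k) (hy k)
  have hterm : ∀ j k, |K (j + 1) k * x (j + 1) * x k * jump i j k
        - K (j + 1) k * y (j + 1) * y k * jump i j k|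
      ≤ 4 * c * ((W (j + 1) * |x (j + 1) - y (j + 1)|) * (W k * x k)
        + (W (j + 1) * y (j + 1)) * (W k * |x k - y k|)) := by
    intro j k
    have e : K (j + 1) k * x (j + 1) * x k * jump i j k
        - K (j + 1) k * y (j + 1) * y k * jump i j k
        = K (j + 1) k * ((x (j + 1) - y (j + 1)) * x k + y (j + 1) * (x k - y k)) * jump i j k := by
      ring
    rw [e, abs_mul, abs_mul, abs_of_nonneg (hKnn _ _)]
    have t : |(x (j + 1) - y (j + 1)) * x k + y (j + 1) * (x k - y k)|
        ≤ |x (j + 1) - y (j + 1)| * x k + y (j + 1) * |x k - y k| := by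
      refine (abs_add_le _ _).trans ?_
      rw [abs_mul, abs_mul, abs_of_nonneg (hx k), abs_of_nonneg (hy (j + 1))]
    have t0 : 0 ≤ |x (j + 1) - y (j + 1)| * x k + y (j + 1) * |x k - y k| :=
      (abs_nonneg _).trans t
    calc _ ≤ c * (W (j + 1) * W k)
            * (|x (j + 1) - y (j + 1)| * x k + y (j + 1) * |x k - y k|) * 4 := by
          have := hK (j + 1) k
          have := abs_jump_le i j k
          have := mul_nonneg hc (mul_nonneg (hW (j + 1)) (hW k))
          gcongr
      _ = _ := by ring
  have sx := hxs.sum_le_tsum (Finset.range (N + 1)) fun k _ => x0 k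
  have sd := hds.sum_le_tsum (Finset.range (N + 1)) fun k _ => d0 k
  have sy' := sum_range_succ_le_tsum y0 hys N
  have sd' := sum_range_succ_le_tsum d0 hds N
  calc _ ≤ ∑ j ∈ Finset.range N, ∑ k ∈ Finset.range (N + 1),
          4 * c * ((W (j + 1) * |x (j + 1) - y (j + 1)|) * (W k * x k)
            + (W (j + 1) * y (j + 1)) * (W k * |x k - y k|)) := by
        simp only [flux, ← Finset.sum_sub_distrib]
        refine (Finset.abs_sum_le_sum_abs _ _).trans (Finset.sum_le_sum fun j _ => ?_)
        exact (Finset.abs_sum_le_sum_abs _ _).trans (Finset.sum_le_sum fun k _ => hterm j k)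
    _ = 4 * c * ((∑ j ∈ Finset.range N, W (j + 1) * |x (j + 1) - y (j + 1)|)
            * (∑ k ∈ Finset.range (N + 1), W k * x k)
          + (∑ j ∈ Finset.range N, W (j + 1) * y (j + 1))
            * ∑ k ∈ Finset.range (N + 1), W k * |x k - y k|) := by
        simp only [← Finset.mul_sum, Finset.sum_add_distrib, ← Finset.sum_mul]
    _ ≤ 4 * c * ((∑' k, W k * |x k - y k|) * (∑' k, W k * x k)
          + (∑' k, W k * y k) * ∑' k, W k * |x k - y k|) := by
        have : 0 ≤ ∑' k, W k * |x k - y k| := tsum_nonneg d0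
        have : 0 ≤ ∑' k, W k * y k := tsum_nonneg y0
        have := Finset.sum_nonneg fun k (_ : k ∈ Finset.range (N + 1)) => x0 k
        have := Finset.sum_nonneg fun k (_ : k ∈ Finset.range (N + 1)) => d0 k
        gcongr
    _ = _ := by ring

lemma abs_flux_le {K : ℕ → ℕ → ℝ} {W x : ℕ → ℝ} {c : ℝ} (hKnn : ∀ j k : ℕ, 0 ≤ K j k)
    (hc : 0 ≤ c) (hW : ∀ k, 0 ≤ W k) (hK : ∀ j k, K j k ≤ c * (W j * W k))
    (hx : ∀ k, 0 ≤ x k) (hxs : Summable fun k => W k * x k) (N i : ℕ) :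
    |flux K N x i| ≤ 4 * c * (∑' k, W k * x k) ^ 2 := by
  have := abs_flux_sub_le hKnn hc hW hK hx (fun _ => le_rfl) hxs (y := 0)
    (by simp) N i
  simp only [Pi.zero_apply, sub_zero, abs_of_nonneg (hx _), mul_zero, tsum_zero, add_zero] at this
  have h0 : flux K N 0 i = 0 := by simp [flux]
  rw [h0, sub_zero] at this
  exact this.trans_eq (by ring)

lemma neg_le_flux {K : ℕ → ℕ → ℝ} {x : ℕ → ℝ} {κ : ℝ} (hKnn : ∀ j k : ℕ, 0 ≤ K j k) (N : ℕ)
    (hK : ∀ j ≤ N, ∀ k ≤ N, K j k ≤ κ) (hx : ∀ k, 0 ≤ x k) (hxs : Summable x) (i : ℕ) :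
    -(2 * κ * (∑' k, x k) * x i) ≤ flux K N x i := by
  have hκ : 0 ≤ κ := (hKnn 0 0).trans (hK 0 (by omega) 0 (by omega))
  have s1 := hxs.sum_le_tsum (Finset.range (N + 1)) fun k _ => hx k
  have s2 := sum_range_succ_le_tsum hx hxs N
  have hterm : ∀ j ∈ Finset.range N, ∀ k ∈ Finset.range (N + 1),
      -(κ * ((if i = j + 1 then x i else 0) * x k + x (j + 1) * (if i = k then x i else 0)))
        ≤ K (j + 1) k * x (j + 1) * x k * jump i j k := by
    intro j hj k hk
    have h1 := hK (j + 1) (by simp at hj; omega) k (by simp at hk; omega)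
    have h2 : K (j + 1) k * (x (j + 1) * x k) ≤ κ * (x (j + 1) * x k) :=
      mul_le_mul_of_nonneg_right h1 (mul_nonneg (hx _) (hx _))
    have h3 : 0 ≤ K (j + 1) k * (x (j + 1) * x k) :=
      mul_nonneg (hKnn _ _) (mul_nonneg (hx _) (hx _))
    have e1 : (if i = j + 1 then x i else 0) = x (j + 1) * (if i = j + 1 then 1 else 0) := by
      split_ifs with h <;> simp [h]
    have e2 : (if i = k then x i else 0) = x k * (if i = k then 1 else 0) := by
      split_ifs with h <;> simp [h]
    rw [e1, e2]
    unfold jump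
    split_ifs <;> linarith
  have hle := Finset.sum_le_sum fun j hj => Finset.sum_le_sum (hterm j hj)
  refine le_trans ?_ hle
  simp only [Finset.sum_neg_distrib, ← Finset.mul_sum, Finset.sum_add_distrib, ← Finset.sum_mul]
  have a1 : ∑ j ∈ Finset.range N, (if i = j + 1 then x i else 0) ≤ x i := by
    cases i with
    | zero => simpa using hx 0
    | succ m =>
      simp only [add_left_inj, Finset.sum_ite_eq]
      split_ifs
      · exact le_rfl
      · exact hx _
  have a2 : ∑ k ∈ Finset.range (N + 1), (if i = k then x i else 0) ≤ x i := by
    simp only [Finset.sum_ite_eq]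
    split_ifs
    · exact le_rfl
    · exact hx _
  have m1 : (∑ j ∈ Finset.range N, (if i = j + 1 then x i else 0))
      * ∑ k ∈ Finset.range (N + 1), x k ≤ x i * ∑' k, x k :=
    mul_le_mul a1 s1 (Finset.sum_nonneg fun k _ => hx k) (hx i)
  have m2 : (∑ j ∈ Finset.range N, x (j + 1))
      * ∑ k ∈ Finset.range (N + 1), (if i = k then x i else 0) ≤ (∑' k, x k) * x i :=
    mul_le_mul s2 a2 (Finset.sum_nonneg fun k _ => by split_ifs; exacts [hx _, le_rfl])
      (tsum_nonneg hx)
  have := mul_le_mul_of_nonneg_left (add_le_add m1 m2) hκ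
  linarith

lemma tendsto_flux {K : ℕ → ℕ → ℝ} (hKsym : ∀ j k : ℕ, K j k = K k j) {x : ℕ → ℝ}
    (h : ∀ j, Summable fun k => K j k * x k) (i : ℕ) :
    Tendsto (fun N => flux K N x i) atTop (nhds (edgRHS K x i)) := by
  have hA : ∀ j, Tendsto (fun N => ∑ k ∈ Finset.range (N + 1), K j k * x k) atTop
      (nhds (∑' k, K j k * x k)) := fun j =>
    (h j).hasSum.tendsto_sum_nat.comp (tendsto_add_atTop_nat 1)
  have hB : ∀ k, Tendsto (fun N => ∑ j ∈ Finset.range N, K (j + 1) k * x (j + 1)) atTop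
      (nhds (∑' j, K (j + 1) k * x (j + 1))) := fun k => by
    have : Summable fun j => K (j + 1) k * x (j + 1) := by
      simpa only [hKsym k] using (summable_nat_add_iff 1).2 (h k)
    exact this.hasSum.tendsto_sum_nat
  have p1 : ∀ (g : ℕ → ℕ → ℝ) (N l : ℕ), l < N → ∑ j ∈ Finset.range N,
      ∑ k ∈ Finset.range (N + 1), g j k * (if l = j then 1 else 0)
        = ∑ k ∈ Finset.range (N + 1), g l k := by
    intro g N l hl
    simp [hl]
  have p2 : ∀ (g : ℕ → ℕ → ℝ) (N l : ℕ), l < N + 1 → ∑ j ∈ Finset.range N,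
      ∑ k ∈ Finset.range (N + 1), g j k * (if l = k then 1 else 0)
        = ∑ j ∈ Finset.range N, g j l := by
    intro g N l hl
    simp [hl]
  have q1 : ∀ N j, ∑ k ∈ Finset.range (N + 1), K (j + 1) k * x (j + 1) * x k
      = x (j + 1) * ∑ k ∈ Finset.range (N + 1), K (j + 1) k * x k := by
    intro N j
    rw [Finset.mul_sum]
    exact Finset.sum_congr rfl fun k _ => by ring
  have q2 : ∀ N k, ∑ j ∈ Finset.range N, K (j + 1) k * x (j + 1) * x k
      = x k * ∑ j ∈ Finset.range N, K (j + 1) k * x (j + 1) := by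
    intro N k
    rw [Finset.mul_sum]
    exact Finset.sum_congr rfl fun j _ => by ring
  cases i with
  | zero =>
    refine (((hA 1).const_mul (x 1)).sub ((hB 0).const_mul (x 0))).congr' ?_
    filter_upwards [eventually_gt_atTop 0] with N hN
    simp only [flux, jump, mul_add, mul_sub, Finset.sum_add_distrib, Finset.sum_sub_distrib]
    rw [p1 _ N 0 hN, p2 _ N 0 (by omega), q1, q2]
    simp
  | succ m =>
    refine (((((hA (m + 2)).const_mul (x (m + 2))).sub ((hA (m + 1)).const_mul (x (m + 1)))).sub
      ((hB (m + 1)).const_mul (x (m + 1)))).add ((hB m).const_mul (x m))).congr' ?_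
    filter_upwards [eventually_gt_atTop (m + 1)] with N hN
    simp only [flux, jump, mul_add, mul_sub, Finset.sum_add_distrib, Finset.sum_sub_distrib,
      add_left_inj]
    rw [p1 _ N (m + 1) hN, p1 _ N m (by omega), p2 _ N (m + 1) (by omega), p2 _ N m (by omega),
      q1, q1, q2, q2]
    ring

/-- The weight `1 + k ^ r`, controlling both the number of particles and the `r`-th moment. -/
noncomputable def sizeWeight (r : ℝ) (k : ℕ) : ℝ := 1 + (k : ℝ) ^ r

lemma sizeWeight_nonneg (r : ℝ) (k : ℕ) : 0 ≤ sizeWeight r k := by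
  unfold sizeWeight; positivity

lemma one_le_sizeWeight (r : ℝ) (k : ℕ) : 1 ≤ sizeWeight r k :=
  le_add_of_nonneg_right (by positivity)

lemma rpow_le_sizeWeight {a r : ℝ} (ha : 0 ≤ a) (har : a ≤ r) (k : ℕ) :
    (k : ℝ) ^ a ≤ sizeWeight r k := by
  unfold sizeWeight
  rcases Nat.eq_zero_or_pos k with rfl | hk
  · have : ((0 : ℕ) : ℝ) ^ a ≤ 1 := Real.rpow_le_one (by simp) (by simp) ha
    have : (0 : ℝ) ≤ ((0 : ℕ) : ℝ) ^ r := by positivity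
    linarith
  · have : (k : ℝ) ^ a ≤ (k : ℝ) ^ r :=
      Real.rpow_le_rpow_of_exponent_le (by exact_mod_cast hk) har
    linarith

lemma cast_le_sizeWeight {r : ℝ} (hr : 1 ≤ r) (k : ℕ) : (k : ℝ) ≤ sizeWeight r k := by
  simpa using rpow_le_sizeWeight zero_le_one hr k

lemma dampedWeight_le_sizeWeight (r : ℝ) (n k : ℕ) : dampedWeight r n k ≤ sizeWeight r k :=
  (dampedWeight_le r n k).trans (le_add_of_nonneg_left zero_le_one)

lemma dampedWeight_one {r : ℝ} (hr : 1 ≤ r) (k : ℕ) : dampedWeight r 1 k = (k : ℝ) ^ r := by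
  unfold dampedWeight
  rcases Nat.eq_zero_or_pos k with rfl | hk
  · simp [Real.zero_rpow (by linarith : r ≠ 0)]
  · have : (1 : ℝ) ≤ k := by exact_mod_cast hk
    simp [this]

lemma sizeWeight_le_dampedWeight {r : ℝ} (hr : 0 ≤ r) {n k : ℕ} (hn : 1 ≤ n) (hk : n ≤ k) :
    sizeWeight r k ≤ 2 * dampedWeight r n k := by
  have hn' : (0 : ℝ) < n := by exact_mod_cast hn
  have hk' : (n : ℝ) ≤ k := by exact_mod_cast hk
  have h1 : (1 : ℝ) ≤ k := by exact_mod_cast hn.trans hk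
  have h2 : (1 : ℝ) ≤ (k : ℝ) / n := by rwa [le_div_iff₀ hn', one_mul]
  have h3 : (1 : ℝ) ≤ (k : ℝ) ^ r := Real.one_le_rpow h1 hr
  rw [dampedWeight, min_eq_left h2, sizeWeight]
  linarith

lemma kernel_le_sizeWeight {K : ℕ → ℕ → ℝ} {Cq μ ν r : ℝ} (hCq : 0 < Cq)
    (hμ : 0 ≤ μ) (hν : 0 ≤ ν) (hμr : μ ≤ r) (hνr : ν ≤ r)
    (hKle : ∀ j k : ℕ, K j k ≤ Cq * ((j : ℝ) ^ μ * (k : ℝ) ^ ν + (j : ℝ) ^ ν * (k : ℝ) ^ μ))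
    (j k : ℕ) : K j k ≤ 2 * Cq * (sizeWeight r j * sizeWeight r k) := by
  calc K j k ≤ _ := hKle j k
    _ ≤ Cq * (sizeWeight r j * sizeWeight r k + sizeWeight r j * sizeWeight r k) := by
        have := rpow_le_sizeWeight hμ hμr j
        have := rpow_le_sizeWeight hν hνr j
        have := rpow_le_sizeWeight hμ hμr k
        have := rpow_le_sizeWeight hν hνr k
        have := sizeWeight_nonneg r j
        gcongr
    _ = _ := by ring

lemma tendsto_tsum_dampedWeight {r : ℝ} {x : ℕ → ℝ} (hx : ∀ k, 0 ≤ x k)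
    (hs : Summable fun k => sizeWeight r k * x k) :
    Tendsto (fun n => ∑' k, dampedWeight r n k * x k) atTop (nhds 0) := by
  have := tendsto_tsum_of_dominated_convergence (𝓕 := atTop)
    (f := fun n k => dampedWeight r n k * x k) (g := fun _ => (0 : ℝ)) hs (fun k => ?_)
    (Eventually.of_forall fun n k => ?_)
  · simpa using this
  · have h1 : Tendsto (fun n : ℕ => min 1 ((k : ℝ) / n)) atTop (nhds (min 1 0)) :=
      tendsto_const_nhds.min (tendsto_const_div_atTop_nhds_zero_nat (k : ℝ))
    simpa [dampedWeight] using (h1.const_mul ((k : ℝ) ^ r)).mul_const (x k)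
  · rw [Real.norm_of_nonneg (mul_nonneg (dampedWeight_nonneg _ _ _) (hx k))]
    exact mul_le_mul_of_nonneg_right (dampedWeight_le_sizeWeight r n k) (hx k)

lemma summable_mul_of_le {w W x : ℕ → ℝ} (hw : ∀ k, 0 ≤ w k) (hwW : ∀ k, w k ≤ W k)
    (hx : ∀ k, 0 ≤ x k) (hs : Summable fun k => W k * x k) : Summable fun k => w k * x k :=
  hs.of_nonneg_of_le (fun k => mul_nonneg (hw k) (hx k))
    fun k => mul_le_mul_of_nonneg_right (hwW k) (hx k)

/-- States whose damped moments are dominated, with factor `A`, by those of a reference state. -/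
structure Tame (r : ℝ) (f0 : ℕ → ℝ) (A : ℝ) (x : ℕ → ℝ) : Prop where
  nonneg : ∀ k, 0 ≤ x k
  summable : Summable fun k => sizeWeight r k * x k
  damped : ∀ n, ∑' k, dampedWeight r n k * x k ≤ A * ∑' k, dampedWeight r n k * f0 k

/-- Tame states with the particle number and mass of the reference state. -/
structure Conserving (r : ℝ) (f0 : ℕ → ℝ) (A : ℝ) (x : ℕ → ℝ) : Prop extends Tame r f0 A x where
  number : ∑' k, x k = ∑' k, f0 k
  mass : ∑' k : ℕ, (k : ℝ) * x k = ∑' k : ℕ, (k : ℝ) * f0 k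

lemma Tame.summable_number {r A : ℝ} {f0 x : ℕ → ℝ} (h : Tame r f0 A x) : Summable x := by
  simpa using summable_mul_of_le (fun _ => zero_le_one) (one_le_sizeWeight r) h.nonneg h.summable

lemma Tame.summable_mass {r A : ℝ} {f0 x : ℕ → ℝ} (hr : 1 ≤ r) (h : Tame r f0 A x) :
    Summable fun k : ℕ => (k : ℝ) * x k :=
  summable_mul_of_le (fun k => k.cast_nonneg) (cast_le_sizeWeight hr) h.nonneg h.summable

lemma Tame.summable_damped {r A : ℝ} {f0 x : ℕ → ℝ} (h : Tame r f0 A x) (n : ℕ) :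
    Summable fun k => dampedWeight r n k * x k :=
  summable_mul_of_le (dampedWeight_nonneg r n) (dampedWeight_le_sizeWeight r n) h.nonneg h.summable

lemma Tame.summable_dist {r A : ℝ} {f0 x y : ℕ → ℝ} (hx : Tame r f0 A x) (hy : Tame r f0 A y) :
    Summable fun k => sizeWeight r k * |x k - y k| := by
  refine (hx.summable.add hy.summable).of_nonneg_of_le
    (fun k => mul_nonneg (sizeWeight_nonneg r k) (abs_nonneg _)) fun k => ?_
  rw [← mul_add]
  have := hx.nonneg k
  have := hy.nonneg k
  exact mul_le_mul_of_nonneg_left (abs_le.2 ⟨by linarith, by linarith⟩) (sizeWeight_nonneg r k)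

lemma Conserving.tsum_sizeWeight_le {r A : ℝ} {f0 x : ℕ → ℝ} (hr : 1 ≤ r) (hA : 1 ≤ A)
    (h0 : Tame r f0 1 f0) (h : Conserving r f0 A x) :
    ∑' k, sizeWeight r k * x k ≤ A * ∑' k, sizeWeight r k * f0 k := by
  have e : ∀ {B : ℝ} {y : ℕ → ℝ}, Tame r f0 B y → ∑' k, sizeWeight r k * y k
      = ∑' k, y k + ∑' k, dampedWeight r 1 k * y k := fun hy => by
    rw [← hy.summable_number.tsum_add (hy.summable_damped 1)]
    exact tsum_congr fun k => by rw [dampedWeight_one hr, sizeWeight]; ring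
  rw [e h.toTame, e h0, h.number, mul_add]
  exact add_le_add (le_mul_of_one_le_left (tsum_nonneg h0.nonneg) hA) (h.damped 1)

/-- On tame states, componentwise closeness of finitely many components implies closeness in the
weighted norm. -/
lemma exists_tsum_dist_le {r : ℝ} {f0 : ℕ → ℝ} (hr : 1 ≤ r) (h0 : Tame r f0 1 f0) (A : ℝ)
    {ε : ℝ} (hε : 0 < ε) :
    ∃ n : ℕ, ∃ δ > 0, ∀ x y, Tame r f0 A x → Tame r f0 A y →
      (∀ k < n, |x k - y k| ≤ δ) → ∑' k, sizeWeight r k * |x k - y k| ≤ ε := by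
  have ht := (tendsto_tsum_dampedWeight h0.nonneg h0.summable).const_mul (4 * A)
  rw [mul_zero] at ht
  obtain ⟨n, hn, hn1⟩ := ((ht.eventually (gt_mem_nhds (half_pos hε))).and
    (eventually_ge_atTop 1)).exists
  set S := ∑ k ∈ Finset.range n, sizeWeight r k
  have hS : 0 ≤ S := Finset.sum_nonneg fun k _ => sizeWeight_nonneg r k
  refine ⟨n, ε / (2 * (S + 1)), by positivity, fun x y hx hy hxy => ?_⟩
  set δ := ε / (2 * (S + 1)) with hδ
  have hδ0 : 0 < δ := by positivity
  have hpt : ∀ k, sizeWeight r k * |x k - y k| ≤ (if k ∈ Finset.range n then sizeWeight r k * δ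
      else 0) + 2 * (dampedWeight r n k * x k + dampedWeight r n k * y k) := by
    intro k
    have x0 := hx.nonneg k
    have y0 := hy.nonneg k
    have d0 := dampedWeight_nonneg r n k
    split_ifs with hk
    · have := mul_le_mul_of_nonneg_left (hxy k (Finset.mem_range.1 hk)) (sizeWeight_nonneg r k)
      have : 0 ≤ 2 * (dampedWeight r n k * x k + dampedWeight r n k * y k) := by positivity
      linarith
    · have h1 := sizeWeight_le_dampedWeight (by linarith : 0 ≤ r) hn1
        (not_lt.1 (mt Finset.mem_range.2 hk))
      have h2 : |x k - y k| ≤ x k + y k := abs_le.2 ⟨by linarith, by linarith⟩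
      calc _ ≤ (2 * dampedWeight r n k) * (x k + y k) := by gcongr
        _ = _ := by ring
  have hsum : HasSum (fun k => (if k ∈ Finset.range n then sizeWeight r k * δ else 0)
      + 2 * (dampedWeight r n k * x k + dampedWeight r n k * y k))
      (S * δ + 2 * (∑' k, dampedWeight r n k * x k + ∑' k, dampedWeight r n k * y k)) := by
    refine HasSum.add ?_ (((hx.summable_damped n).hasSum.add
      (hy.summable_damped n).hasSum).mul_left 2)
    rw [Finset.sum_mul]
    have := hasSum_sum_of_ne_finset_zero (L := SummationFilter.unconditional ℕ)
      (s := Finset.range n)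
      (f := fun k => if k ∈ Finset.range n then sizeWeight r k * δ else 0)
      fun k hk => if_neg hk
    rwa [Finset.sum_congr rfl fun k hk => if_pos hk] at this
  have hle := hasSum_le hpt (hx.summable_dist hy).hasSum hsum
  have h1 := hx.damped n
  have h2 := hy.damped n
  have h3 : S * δ ≤ ε / 2 := by
    rw [hδ, mul_div_assoc', div_le_div_iff₀ (by positivity) (by positivity)]
    nlinarith
  linarith

lemma Conserving.mono {r A B : ℝ} {f0 x : ℕ → ℝ} (h0 : ∀ k, 0 ≤ f0 k) (hAB : A ≤ B)
    (h : Conserving r f0 A x) : Conserving r f0 B x where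
  nonneg := h.nonneg
  summable := h.summable
  damped n := (h.damped n).trans (mul_le_mul_of_nonneg_right hAB
    (tsum_nonneg fun k => mul_nonneg (dampedWeight_nonneg r n k) (h0 k)))
  number := h.number
  mass := h.mass

lemma Conserving.of_tendsto {r A : ℝ} {f0 g : ℕ → ℝ} {u : ℕ → ℕ → ℝ} {l : Filter ℕ} [l.NeBot]
    (hr : 1 ≤ r) (hA : 1 ≤ A) (h0 : Tame r f0 1 f0) (hu : ∀ N, Conserving r f0 A (u N))
    (hlim : ∀ k, Tendsto (fun N => u N k) l (nhds (g k))) :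
    Conserving r f0 A g ∧
      Tendsto (fun N => ∑' k, sizeWeight r k * |u N k - g k|) l (nhds 0) := by
  have g0 : ∀ k, 0 ≤ g k := fun k =>
    ge_of_tendsto (hlim k) (Eventually.of_forall fun N => (hu N).nonneg k)
  have hfin : ∀ (w : ℕ → ℝ) (s : Finset ℕ),
      Tendsto (fun N => ∑ k ∈ s, w k * u N k) l (nhds (∑ k ∈ s, w k * g k)) := fun w s =>
    tendsto_finsetSum s fun k _ => (hlim k).const_mul (w k)
  have gs : Summable fun k => sizeWeight r k * g k := by
    refine summable_of_sum_le (fun k => mul_nonneg (sizeWeight_nonneg r k) (g0 k))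
      (c := A * ∑' k, sizeWeight r k * f0 k) fun s => ?_
    refine le_of_tendsto (hfin _ s) (Eventually.of_forall fun N => ?_)
    exact ((hu N).summable.sum_le_tsum s fun k _ =>
      mul_nonneg (sizeWeight_nonneg r k) ((hu N).nonneg k)).trans
      ((hu N).tsum_sizeWeight_le hr hA h0)
  have gt : Tame r f0 A g := by
    refine ⟨g0, gs, fun n => ?_⟩
    refine Summable.tsum_le_of_sum_le (summable_mul_of_le (dampedWeight_nonneg r n)
      (dampedWeight_le_sizeWeight r n) g0 gs) fun s => ?_
    refine le_of_tendsto (hfin _ s) (Eventually.of_forall fun N => ?_)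
    exact (((hu N).summable_damped n).sum_le_tsum s fun k _ =>
      mul_nonneg (dampedWeight_nonneg r n k) ((hu N).nonneg k)).trans ((hu N).damped n)
  have hdist : Tendsto (fun N => ∑' k, sizeWeight r k * |u N k - g k|) l (nhds 0) := by
    rw [Metric.tendsto_nhds]
    intro ε hε
    obtain ⟨n, δ, hδ, H⟩ := exists_tsum_dist_le hr h0 A (half_pos hε)
    have hev : ∀ᶠ N in l, ∀ k ∈ Finset.range n, |u N k - g k| < δ := by
      rw [Filter.eventually_all_finset]
      intro k _
      simpa [Real.dist_eq] using Metric.tendsto_nhds.1 (hlim k) δ hδ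
    filter_upwards [hev] with N hN
    have := H (u N) g (hu N).toTame gt fun k hk => (hN k (Finset.mem_range.2 hk)).le
    rw [Real.dist_0_eq_abs, abs_of_nonneg
      (tsum_nonneg fun k => mul_nonneg (sizeWeight_nonneg r k) (abs_nonneg _))]
    linarith
  have hcons : ∀ (w : ℕ → ℝ) (M : ℝ), (∀ k, 0 ≤ w k) → (∀ k, w k ≤ sizeWeight r k) →
      (∀ N, ∑' k, w k * u N k = M) → ∑' k, w k * g k = M := by
    intro w M w0 wW hM
    have su : ∀ N, Summable fun k => w k * u N k := fun N =>
      summable_mul_of_le w0 wW (hu N).nonneg (hu N).summable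
    have sg := summable_mul_of_le w0 wW g0 gs
    have hb : ∀ N, |M - ∑' k, w k * g k| ≤ ∑' k, sizeWeight r k * |u N k - g k| := by
      intro N
      rw [← hM N, ← (su N).tsum_sub sg, ← Real.norm_eq_abs]
      refine tsum_of_norm_bounded ((hu N).toTame.summable_dist gt).hasSum fun k => ?_
      rw [← mul_sub, Real.norm_eq_abs, abs_mul, abs_of_nonneg (w0 k)]
      exact mul_le_mul_of_nonneg_right (wW k) (abs_nonneg _)
    have := ge_of_tendsto hdist (Eventually.of_forall hb)
    have := abs_nonpos_iff.1 this
    linarith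
  refine ⟨⟨gt, ?_, ?_⟩, hdist⟩
  · simpa using hcons 1 _ (fun _ => zero_le_one) (one_le_sizeWeight r)
      (fun N => by simpa using (hu N).number)
  · exact hcons (fun k => (k : ℝ)) _ (fun k => k.cast_nonneg) (cast_le_sizeWeight hr)
      fun N => (hu N).mass

/-- Explicit Euler scheme with step `h` for the truncated EDG system. -/
noncomputable def euler (K : ℕ → ℕ → ℝ) (N : ℕ) (h : ℝ) (f0 : ℕ → ℝ) : ℕ → ℕ → ℝ
  | 0 => f0
  | m + 1 => fun i => euler K N h f0 m i + h * flux K N (euler K N h f0 m) i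

/-- A bound for the truncated kernel. -/
noncomputable def kernelBound (K : ℕ → ℕ → ℝ) (N : ℕ) : ℝ :=
  ∑ j ∈ Finset.range (N + 1), ∑ k ∈ Finset.range (N + 1), K j k

lemma le_kernelBound {K : ℕ → ℕ → ℝ} (hKnn : ∀ j k : ℕ, 0 ≤ K j k) {N j k : ℕ} (hj : j ≤ N)
    (hk : k ≤ N) : K j k ≤ kernelBound K N :=
  (Finset.single_le_sum (f := fun k => K j k) (fun k _ => hKnn j k)
    (Finset.mem_range.2 (Nat.lt_succ_of_le hk))).trans
  (Finset.single_le_sum (f := fun j => ∑ k ∈ Finset.range (N + 1), K j k)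
    (fun j _ => Finset.sum_nonneg fun k _ => hKnn j k)
    (Finset.mem_range.2 (Nat.lt_succ_of_le hj)))

lemma Conserving.euler_step {K : ℕ → ℕ → ℝ} {r A C h : ℝ} {f0 x : ℕ → ℝ}
    (hKnn : ∀ j k : ℕ, 0 ≤ K j k) (hKsym : ∀ j k : ℕ, K j k = K k j) (hr : 1 ≤ r) (hC : 0 ≤ C)
    (hdrift : ∀ n j k, 1 ≤ k →
      K (j + 1) k * (dampedWeight r n (j + 2) - 2 * dampedWeight r n (j + 1) + dampedWeight r n j)
        ≤ C * (dampedWeight r n (j + 1) * k + dampedWeight r n k * (j + 1 : ℕ)))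
    (hx : Conserving r f0 A x) (N : ℕ) (hh : 0 ≤ h)
    (hstep : h * (2 * kernelBound K N * ∑' k, f0 k) ≤ 1) :
    Conserving r f0 (A * (1 + 2 * C * (∑' k : ℕ, (k : ℝ) * f0 k) * h))
      (fun i => x i + h * flux K N x i) := by
  have hadd : ∀ {w : ℕ → ℝ} {s : ℝ}, Summable (fun k => w k * x k) →
      HasSum (fun k => w k * flux K N x k) s →
      HasSum (fun k => w k * (x k + h * flux K N x k)) (∑' k, w k * x k + h * s) := by
    intro w s hw hs
    exact (hw.hasSum.add (hs.mul_left h)).congr_fun fun k => by ring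
  refine ⟨⟨fun i => ?_, ?_, fun n => ?_⟩, ?_, ?_⟩
  · have h1 := neg_le_flux hKnn N (fun j hj k hk => le_kernelBound hKnn hj hk) hx.nonneg
      hx.summable_number i
    rw [hx.number] at h1
    have h2 := mul_le_mul_of_nonneg_left h1 hh
    have h3 := mul_le_mul_of_nonneg_right hstep (hx.nonneg i)
    linarith
  · exact (hadd hx.summable (hasSum_mul_flux K N x _)).summable
  · rw [(hadd (hx.summable_damped n) (hasSum_mul_flux K N x _)).tsum_eq]
    have h1 := sum_mul_flux_le hKnn hKsym hC hx.nonneg (dampedWeight_nonneg r n)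
      (dampedWeight_zero r n) (dampedWeight_one_le_diff hr n) (hdrift n) (hx.summable_mass hr)
      (hx.summable_damped n) N
    rw [hx.mass] at h1
    have m0 : 0 ≤ ∑' k : ℕ, (k : ℝ) * f0 k :=
      hx.mass ▸ tsum_nonneg fun k => mul_nonneg k.cast_nonneg (hx.nonneg k)
    have h2 := mul_le_mul_of_nonneg_left h1 hh
    calc _ ≤ (1 + 2 * C * (∑' k : ℕ, (k : ℝ) * f0 k) * h) * ∑' k, dampedWeight r n k * x k := by
          linarith
      _ ≤ (1 + 2 * C * (∑' k : ℕ, (k : ℝ) * f0 k) * h) * (A * ∑' k, dampedWeight r n k * f0 k) :=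
          mul_le_mul_of_nonneg_left (hx.damped n) (by positivity)
      _ = _ := by ring
  · have := hadd (w := 1) (by simpa using hx.summable_number) (by simpa using hasSum_flux K N x)
    simpa [hx.number] using this.tsum_eq
  · have := hadd (w := fun k => (k : ℝ)) (hx.summable_mass hr) (hasSum_nat_mul_flux K N x)
    simpa [hx.mass] using this.tsum_eq

lemma conserving_euler {K : ℕ → ℕ → ℝ} {r C h : ℝ} {f0 : ℕ → ℝ}
    (hKnn : ∀ j k : ℕ, 0 ≤ K j k) (hKsym : ∀ j k : ℕ, K j k = K k j) (hr : 1 ≤ r) (hC : 0 ≤ C)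
    (hdrift : ∀ n j k, 1 ≤ k →
      K (j + 1) k * (dampedWeight r n (j + 2) - 2 * dampedWeight r n (j + 1) + dampedWeight r n j)
        ≤ C * (dampedWeight r n (j + 1) * k + dampedWeight r n k * (j + 1 : ℕ)))
    (h0 : Tame r f0 1 f0) (N : ℕ) (hh : 0 ≤ h)
    (hstep : h * (2 * kernelBound K N * ∑' k, f0 k) ≤ 1) (m : ℕ) :
    Conserving r f0 (Real.exp (2 * C * (∑' k : ℕ, (k : ℝ) * f0 k) * (m * h)))
      (euler K N h f0 m) := by
  induction m with
  | zero => simpa [euler] using (⟨h0, rfl, rfl⟩ : Conserving r f0 1 f0)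
  | succ m ih =>
    refine (ih.euler_step hKnn hKsym hr hC hdrift N hh hstep).mono h0.nonneg ?_
    set D := 2 * C * ∑' k : ℕ, (k : ℝ) * f0 k
    calc _ ≤ Real.exp (D * (m * h)) * Real.exp (D * h) := by
          gcongr
          linarith [Real.add_one_le_exp (D * h)]
      _ = _ := by rw [← Real.exp_add]; push_cast; ring_nf

lemma abs_euler_sub_le {K : ℕ → ℕ → ℝ} {N : ℕ} {h : ℝ} {f0 : ℕ → ℝ} (hh : 0 ≤ h) {c ε : ℝ}
    {n m i : ℕ} (hnm : n ≤ m)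
    (hflux : ∀ l, n ≤ l → l < m → |flux K N (euler K N h f0 l) i - c| ≤ ε) :
    |euler K N h f0 m i - euler K N h f0 n i - (m * h - n * h) * c| ≤ (m * h - n * h) * ε := by
  induction m, hnm using Nat.le_induction with
  | base => simp
  | succ m hnm ih =>
    have h1 := ih fun l hl hlm => hflux l hl (by omega)
    have h2 := hflux m hnm (by omega)
    have e : euler K N h f0 (m + 1) i - euler K N h f0 n i - ((m + 1 : ℕ) * h - n * h) * c
        = (euler K N h f0 m i - euler K N h f0 n i - (m * h - n * h) * c)
          + h * (flux K N (euler K N h f0 m) i - c) := by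
      simp only [euler]; push_cast; ring
    rw [e]
    refine (abs_add_le _ _).trans ?_
    rw [abs_mul, abs_of_nonneg hh]
    have := mul_le_mul_of_nonneg_left h2 hh
    push_cast
    linarith

/-- Step size of the Euler scheme at truncation level `N`. -/
noncomputable def stepSize (K : ℕ → ℕ → ℝ) (f0 : ℕ → ℝ) (N : ℕ) : ℝ :=
  1 / ((N + 1) * (1 + 2 * kernelBound K N * ∑' k, f0 k))

section StepSize

variable {K : ℕ → ℕ → ℝ} {f0 : ℕ → ℝ}

lemma one_le_stepSize_factor (hKnn : ∀ j k : ℕ, 0 ≤ K j k) (h0 : ∀ k, 0 ≤ f0 k) (N : ℕ) :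
    1 ≤ 1 + 2 * kernelBound K N * ∑' k, f0 k := by
  have h1 : 0 ≤ kernelBound K N :=
    Finset.sum_nonneg fun j _ => Finset.sum_nonneg fun k _ => hKnn j k
  have h2 : 0 ≤ ∑' k, f0 k := tsum_nonneg h0
  have : 0 ≤ 2 * kernelBound K N * ∑' k, f0 k := by positivity
  linarith

lemma stepSize_pos (hKnn : ∀ j k : ℕ, 0 ≤ K j k) (h0 : ∀ k, 0 ≤ f0 k) (N : ℕ) :
    0 < stepSize K f0 N := by
  have := one_le_stepSize_factor hKnn h0 N
  unfold stepSize
  positivity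

lemma stepSize_mul_le (hKnn : ∀ j k : ℕ, 0 ≤ K j k) (h0 : ∀ k, 0 ≤ f0 k) (N : ℕ) :
    stepSize K f0 N * (2 * kernelBound K N * ∑' k, f0 k) ≤ 1 := by
  have h1 := one_le_stepSize_factor hKnn h0 N
  have h2 : (0 : ℝ) ≤ N := N.cast_nonneg
  unfold stepSize
  rw [one_div_mul_eq_div, div_le_one (by positivity)]
  nlinarith

lemma tendsto_stepSize (hKnn : ∀ j k : ℕ, 0 ≤ K j k) (h0 : ∀ k, 0 ≤ f0 k) :
    Tendsto (stepSize K f0) atTop (nhds 0) := by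
  refine squeeze_zero (fun N => (stepSize_pos hKnn h0 N).le) (fun N => ?_)
    tendsto_one_div_add_atTop_nhds_zero_nat
  have h1 := one_le_stepSize_factor hKnn h0 N
  have h2 : (0 : ℝ) ≤ N := N.cast_nonneg
  unfold stepSize
  gcongr
  nlinarith

lemma floor_mul_stepSize_le (hKnn : ∀ j k : ℕ, 0 ≤ K j k) (h0 : ∀ k, 0 ≤ f0 k) {t : ℝ}
    (ht : 0 ≤ t) (N : ℕ) : (⌊t / stepSize K f0 N⌋₊ : ℝ) * stepSize K f0 N ≤ t :=
  have hp := stepSize_pos hKnn h0 N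
  (le_div_iff₀ hp).1 (Nat.floor_le (by positivity))

lemma tendsto_floor_mul_stepSize (hKnn : ∀ j k : ℕ, 0 ≤ K j k) (h0 : ∀ k, 0 ≤ f0 k) {t : ℝ}
    (ht : 0 ≤ t) :
    Tendsto (fun N => (⌊t / stepSize K f0 N⌋₊ : ℝ) * stepSize K f0 N) atTop (nhds t) := by
  have hl : Tendsto (fun N => t - stepSize K f0 N) atTop (nhds t) := by
    simpa using tendsto_const_nhds.sub (tendsto_stepSize hKnn h0)
  refine tendsto_of_tendsto_of_tendsto_of_le_of_le hl tendsto_const_nhds (fun N => ?_)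
    (floor_mul_stepSize_le hKnn h0 ht)
  have := (Nat.lt_floor_add_one (t / stepSize K f0 N)).le
  rw [div_le_iff₀ (stepSize_pos hKnn h0 N)] at this
  simp only
  linarith

end StepSize

/-- Piecewise constant interpolation of the Euler scheme. -/
noncomputable def eulerInterp (K : ℕ → ℕ → ℝ) (f0 : ℕ → ℝ) (N : ℕ) (t : ℝ) : ℕ → ℝ :=
  euler K N (stepSize K f0 N) f0 ⌊t / stepSize K f0 N⌋₊

/-- The limit of the interpolated Euler schemes along a nonprincipal ultrafilter. -/
noncomputable def edgLimit (K : ℕ → ℕ → ℝ) (f0 : ℕ → ℝ) (t : ℝ) (i : ℕ) : ℝ :=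
  limUnder (hyperfilter ℕ : Filter ℕ) fun N => eulerInterp K f0 N t i

lemma edgLimit_zero (K : ℕ → ℕ → ℝ) (f0 : ℕ → ℝ) : edgLimit K f0 0 = f0 := by
  funext i
  simp only [edgLimit, eulerInterp, zero_div, Nat.floor_zero, euler]
  exact tendsto_const_nhds.limUnder_eq

section Limit

variable {K : ℕ → ℕ → ℝ} {r C c : ℝ} {f0 : ℕ → ℝ}

lemma conserving_eulerInterp (hKnn : ∀ j k : ℕ, 0 ≤ K j k) (hKsym : ∀ j k : ℕ, K j k = K k j)
    (hr : 1 ≤ r) (hC : 0 ≤ C)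
    (hdrift : ∀ n j k, 1 ≤ k →
      K (j + 1) k * (dampedWeight r n (j + 2) - 2 * dampedWeight r n (j + 1) + dampedWeight r n j)
        ≤ C * (dampedWeight r n (j + 1) * k + dampedWeight r n k * (j + 1 : ℕ)))
    (h0 : Tame r f0 1 f0) {T : ℝ} {N m : ℕ} (hm : m * stepSize K f0 N ≤ T) :
    Conserving r f0 (Real.exp (2 * C * (∑' k : ℕ, (k : ℝ) * f0 k) * T))
      (euler K N (stepSize K f0 N) f0 m) := by
  refine (conserving_euler hKnn hKsym hr hC hdrift h0 N (stepSize_pos hKnn h0.nonneg N).le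
    (stepSize_mul_le hKnn h0.nonneg N) m).mono h0.nonneg (Real.exp_le_exp.2 ?_)
  have : 0 ≤ ∑' k : ℕ, (k : ℝ) * f0 k :=
    tsum_nonneg fun k => mul_nonneg k.cast_nonneg (h0.nonneg k)
  gcongr

lemma tendsto_eulerInterp (hKnn : ∀ j k : ℕ, 0 ≤ K j k) (hKsym : ∀ j k : ℕ, K j k = K k j)
    (hr : 1 ≤ r) (hC : 0 ≤ C)
    (hdrift : ∀ n j k, 1 ≤ k →
      K (j + 1) k * (dampedWeight r n (j + 2) - 2 * dampedWeight r n (j + 1) + dampedWeight r n j)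
        ≤ C * (dampedWeight r n (j + 1) * k + dampedWeight r n k * (j + 1 : ℕ)))
    (h0 : Tame r f0 1 f0) {t : ℝ} (ht : 0 ≤ t) (i : ℕ) :
    Tendsto (fun N => eulerInterp K f0 N t i) (hyperfilter ℕ) (nhds (edgLimit K f0 t i)) := by
  have hmem : ∀ N, eulerInterp K f0 N t i ∈ Set.Icc 0 (∑' k, f0 k) := fun N => by
    have h := conserving_eulerInterp hKnn hKsym hr hC hdrift h0
      (floor_mul_stepSize_le hKnn h0.nonneg ht N)
    exact ⟨h.nonneg i, h.number ▸ h.summable_number.le_tsum i fun j _ => h.nonneg j⟩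
  obtain ⟨y, -, hy⟩ := isCompact_Icc.ultrafilter_le_nhds
    ((hyperfilter ℕ).map fun N => eulerInterp K f0 N t i)
    (le_principal_iff.2 (Ultrafilter.mem_map.2 (univ_mem' hmem)))
  exact tendsto_nhds_limUnder ⟨y, hy⟩

lemma conserving_edgLimit (hKnn : ∀ j k : ℕ, 0 ≤ K j k) (hKsym : ∀ j k : ℕ, K j k = K k j)
    (hr : 1 ≤ r) (hC : 0 ≤ C)
    (hdrift : ∀ n j k, 1 ≤ k →
      K (j + 1) k * (dampedWeight r n (j + 2) - 2 * dampedWeight r n (j + 1) + dampedWeight r n j)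
        ≤ C * (dampedWeight r n (j + 1) * k + dampedWeight r n k * (j + 1 : ℕ)))
    (h0 : Tame r f0 1 f0) {t : ℝ} (ht : 0 ≤ t) :
    Conserving r f0 (Real.exp (2 * C * (∑' k : ℕ, (k : ℝ) * f0 k) * t)) (edgLimit K f0 t) ∧
      Tendsto (fun N => ∑' k, sizeWeight r k * |eulerInterp K f0 N t k - edgLimit K f0 t k|)
        (hyperfilter ℕ) (nhds 0) := by
  have : 0 ≤ ∑' k : ℕ, (k : ℝ) * f0 k :=
    tsum_nonneg fun k => mul_nonneg k.cast_nonneg (h0.nonneg k)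
  exact Conserving.of_tendsto hr (Real.one_le_exp (by positivity)) h0
    (fun N => conserving_eulerInterp hKnn hKsym hr hC hdrift h0
      (floor_mul_stepSize_le hKnn h0.nonneg ht N))
    (tendsto_eulerInterp hKnn hKsym hr hC hdrift h0 ht)

lemma Tame.summable_kernel {A : ℝ} {x : ℕ → ℝ} (hKnn : ∀ j k : ℕ, 0 ≤ K j k)
    (hK : ∀ j k, K j k ≤ c * (sizeWeight r j * sizeWeight r k)) (hx : Tame r f0 A x) (j : ℕ) :
    Summable fun k => K j k * x k := by
  refine summable_mul_of_le (hKnn j) (W := fun k => c * sizeWeight r j * sizeWeight r k)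
    (fun k => (hK j k).trans_eq (by ring)) hx.nonneg ?_
  simpa only [mul_assoc] using (hx.summable.mul_left (sizeWeight r j)).mul_left c

lemma tendsto_flux_eulerInterp (hKnn : ∀ j k : ℕ, 0 ≤ K j k) (hKsym : ∀ j k : ℕ, K j k = K k j)
    (hr : 1 ≤ r) (hC : 0 ≤ C)
    (hdrift : ∀ n j k, 1 ≤ k →
      K (j + 1) k * (dampedWeight r n (j + 2) - 2 * dampedWeight r n (j + 1) + dampedWeight r n j)
        ≤ C * (dampedWeight r n (j + 1) * k + dampedWeight r n k * (j + 1 : ℕ)))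
    (hc : 0 ≤ c) (hK : ∀ j k, K j k ≤ c * (sizeWeight r j * sizeWeight r k))
    (h0 : Tame r f0 1 f0) {t : ℝ} (ht : 0 ≤ t) (i : ℕ) :
    Tendsto (fun N => flux K N (eulerInterp K f0 N t) i) (hyperfilter ℕ)
      (nhds (edgRHS K (edgLimit K f0 t) i)) := by
  obtain ⟨hf, hd⟩ := conserving_edgLimit hKnn hKsym hr hC hdrift h0 ht
  have hA : 1 ≤ Real.exp (2 * C * (∑' k : ℕ, (k : ℝ) * f0 k) * t) := by
    have : 0 ≤ ∑' k : ℕ, (k : ℝ) * f0 k :=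
      tsum_nonneg fun k => mul_nonneg k.cast_nonneg (h0.nonneg k)
    exact Real.one_le_exp (by positivity)
  have h1 : Tendsto (fun N => flux K N (edgLimit K f0 t) i) (hyperfilter ℕ)
      (nhds (edgRHS K (edgLimit K f0 t) i)) :=
    (tendsto_flux hKsym (hf.toTame.summable_kernel hKnn hK) i).mono_left Nat.hyperfilter_le_atTop
  set B := Real.exp (2 * C * (∑' k : ℕ, (k : ℝ) * f0 k) * t) * ∑' k, sizeWeight r k * f0 k
  have h2 : Tendsto (fun N => flux K N (eulerInterp K f0 N t) i - flux K N (edgLimit K f0 t) i)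
      (hyperfilter ℕ) (nhds 0) := by
    have h3 := hd.const_mul (4 * c * (B + B))
    rw [mul_zero] at h3
    refine squeeze_zero_norm (fun N => ?_) h3
    have hu : Conserving r f0 _ (eulerInterp K f0 N t) :=
      conserving_eulerInterp hKnn hKsym hr hC hdrift h0
        (floor_mul_stepSize_le hKnn h0.nonneg ht N)
    refine (abs_flux_sub_le hKnn hc (sizeWeight_nonneg r) hK hu.nonneg hf.nonneg hu.summable
      hf.summable N i).trans ?_
    have b1 := hu.tsum_sizeWeight_le hr hA h0
    have b2 := hf.tsum_sizeWeight_le hr hA h0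
    have : 0 ≤ ∑' k, sizeWeight r k * |eulerInterp K f0 N t k - edgLimit K f0 t k| :=
      tsum_nonneg fun k => mul_nonneg (sizeWeight_nonneg r k) (abs_nonneg _)
    gcongr
  simpa using h2.add h1

/-- The limit satisfies the EDG system to first order, uniformly on compact time intervals. -/
lemma exists_abs_edgLimit_sub_le (hKnn : ∀ j k : ℕ, 0 ≤ K j k)
    (hKsym : ∀ j k : ℕ, K j k = K k j) (hr : 1 ≤ r) (hC : 0 ≤ C)
    (hdrift : ∀ n j k, 1 ≤ k →
      K (j + 1) k * (dampedWeight r n (j + 2) - 2 * dampedWeight r n (j + 1) + dampedWeight r n j)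
        ≤ C * (dampedWeight r n (j + 1) * k + dampedWeight r n k * (j + 1 : ℕ)))
    (hc : 0 ≤ c) (hK : ∀ j k, K j k ≤ c * (sizeWeight r j * sizeWeight r k))
    (h0 : Tame r f0 1 f0) {T : ℝ} (hT : 0 ≤ T) (i : ℕ) {ε : ℝ} (hε : 0 < ε) :
    ∃ δ > 0, ∀ s u t, 0 ≤ s → s ≤ u → u ≤ t → t ≤ T → t - s ≤ δ →
      |edgLimit K f0 t i - edgLimit K f0 s i - (t - s) * edgRHS K (edgLimit K f0 u) i|
        ≤ (t - s) * ε := by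
  set A := Real.exp (2 * C * (∑' k : ℕ, (k : ℝ) * f0 k) * T) with hAdef
  have hA : 1 ≤ A := by
    have : 0 ≤ ∑' k : ℕ, (k : ℝ) * f0 k :=
      tsum_nonneg fun k => mul_nonneg k.cast_nonneg (h0.nonneg k)
    exact Real.one_le_exp (by positivity)
  set B := A * ∑' k, sizeWeight r k * f0 k with hB
  have hB0 : 0 ≤ B := mul_nonneg (by positivity)
    (tsum_nonneg fun k => mul_nonneg (sizeWeight_nonneg r k) (h0.nonneg k))
  set L := 4 * c * B ^ 2 with hL
  have hL0 : 0 ≤ L := by positivity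
  obtain ⟨n, δ, hδ, hclose⟩ := exists_tsum_dist_le hr h0 A
    (ε := ε / (4 * c * (B + B) + 1)) (by positivity)
  refine ⟨δ / (2 * (L + 1)), by positivity, fun s u t hs hsu hut htT hts => ?_⟩
  have hu := hs.trans hsu
  have ht := hu.trans hut
  have hcons : ∀ {N m : ℕ}, m * stepSize K f0 N ≤ T →
      Conserving r f0 A (euler K N (stepSize K f0 N) f0 m) := fun hm =>
    conserving_eulerInterp hKnn hKsym hr hC hdrift h0 hm
  have hfl : ∀ {τ : ℝ} (N : ℕ), 0 ≤ τ → (⌊τ / stepSize K f0 N⌋₊ : ℝ) * stepSize K f0 N ≤ τ :=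
    fun N hτ => floor_mul_stepSize_le hKnn h0.nonneg hτ N
  have hle : (hyperfilter ℕ : Filter ℕ) ≤ atTop := Nat.hyperfilter_le_atTop
  have hmul : ∀ {τ : ℝ}, 0 ≤ τ →
      Tendsto (fun N => (⌊τ / stepSize K f0 N⌋₊ : ℝ) * stepSize K f0 N) (hyperfilter ℕ)
        (nhds τ) := fun hτ =>
    (tendsto_floor_mul_stepSize hKnn h0.nonneg hτ).mono_left hle
  have hlim : ∀ {τ : ℝ}, 0 ≤ τ → Tendsto (fun N => eulerInterp K f0 N τ i) (hyperfilter ℕ)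
      (nhds (edgLimit K f0 τ i)) := fun hτ =>
    tendsto_eulerInterp hKnn hKsym hr hC hdrift h0 hτ i
  have hΦ := tendsto_flux_eulerInterp hKnn hKsym hr hC hdrift hc hK h0 hu i
  refine le_of_tendsto_of_tendsto
    (((hlim ht).sub (hlim hs)).sub (((hmul ht).sub (hmul hs)).mul hΦ)).abs
    (((hmul ht).sub (hmul hs)).mul_const ε) ?_
  have hsmall : ∀ᶠ N in (hyperfilter ℕ : Filter ℕ), stepSize K f0 N < δ / (2 * (L + 1)) :=
    hle ((tendsto_stepSize hKnn h0.nonneg).eventually (gt_mem_nhds (by positivity)))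
  filter_upwards [hsmall] with N hN
  have hp := stepSize_pos hKnn h0.nonneg N
  set h := stepSize K f0 N
  have hfloor : ∀ {a b : ℝ}, a ≤ b → ⌊a / h⌋₊ ≤ ⌊b / h⌋₊ := fun hab =>
    Nat.floor_le_floor (by gcongr)
  have hT' : ∀ {l : ℕ}, l ≤ ⌊t / h⌋₊ → l * h ≤ T := fun {l} hl => by
    have : (l : ℝ) * h ≤ (⌊t / h⌋₊ : ℝ) * h := by gcongr
    exact this.trans ((hfl N ht).trans htT)
  have hLip : ∀ {p q : ℕ} (k : ℕ), p ≤ q → q ≤ ⌊t / h⌋₊ →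
      |euler K N h f0 q k - euler K N h f0 p k| ≤ (q * h - p * h) * L := by
    intro p q k hpq hq
    have := abs_euler_sub_le (K := K) (N := N) (f0 := f0) (i := k) (c := 0) (ε := L) hp.le hpq
      fun l _ hlq => by
        have hx := hcons (hT' (by omega : l ≤ ⌊t / h⌋₊))
        rw [sub_zero]
        refine (abs_flux_le hKnn hc (sizeWeight_nonneg r) hK hx.nonneg hx.summable N k).trans ?_
        have b := hx.tsum_sizeWeight_le hr hA h0
        have : 0 ≤ ∑' k, sizeWeight r k * euler K N h f0 l k :=
          tsum_nonneg fun k => mul_nonneg (sizeWeight_nonneg r k) (hx.nonneg k)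
        rw [hL]
        gcongr
    simpa using this
  have hspan : ((⌊t / h⌋₊ : ℝ) * h - (⌊s / h⌋₊ : ℝ) * h) * L ≤ δ := by
    have h1 := hfl N ht
    have h2 := (Nat.lt_floor_add_one (s / h)).le
    rw [div_le_iff₀ hp] at h2
    have h3 : (⌊t / h⌋₊ : ℝ) * h - (⌊s / h⌋₊ : ℝ) * h ≤ δ / (L + 1) := by
      have : δ / (L + 1) = δ / (2 * (L + 1)) + δ / (2 * (L + 1)) := by field_simp; ring
      linarith
    calc _ ≤ δ / (L + 1) * L := by gcongr
      _ ≤ δ := by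
        rw [div_mul_eq_mul_div, div_le_iff₀ (by positivity)]
        nlinarith
  have hdist : ∀ {p q : ℕ} (k : ℕ), ⌊s / h⌋₊ ≤ p → p ≤ q → q ≤ ⌊t / h⌋₊ →
      |euler K N h f0 q k - euler K N h f0 p k| ≤ δ := by
    intro p q k hsp hpq hqt
    refine (hLip k hpq hqt).trans (le_trans ?_ hspan)
    gcongr
  refine abs_euler_sub_le hp.le (hfloor (hsu.trans hut)) fun l hsl hlt => ?_
  have hx := hcons (hT' hlt.le)
  have hy : Conserving r f0 A (eulerInterp K f0 N u) := hcons (hT' (hfloor hut))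
  have hd := hclose _ _ hx.toTame hy.toTame fun k _ => by
    rcases le_total l ⌊u / h⌋₊ with hlu | hlu
    · rw [abs_sub_comm]
      exact hdist k hsl hlu (hfloor hut)
    · exact hdist k (hfloor hsu) hlu hlt.le
  refine (abs_flux_sub_le hKnn hc (sizeWeight_nonneg r) hK hx.nonneg hy.nonneg hx.summable
    hy.summable N i).trans ?_
  have b1 := hx.tsum_sizeWeight_le hr hA h0
  have b2 := hy.tsum_sizeWeight_le hr hA h0
  have d0 : 0 ≤ ∑' k, sizeWeight r k * |euler K N h f0 l k - eulerInterp K f0 N u k| :=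
    tsum_nonneg fun k => mul_nonneg (sizeWeight_nonneg r k) (abs_nonneg _)
  calc _ ≤ 4 * c * (B + B) * (ε / (4 * c * (B + B) + 1)) := by gcongr
    _ ≤ ε := by
      rw [mul_div_assoc', div_le_iff₀ (by positivity)]
      nlinarith

end Limit

/-- A curve satisfying an ordinary differential equation to first order, uniformly on compact time
intervals, is continuously differentiable. -/
lemma hasDerivWithinAt_and_continuousOn_of_first_order {f Φ : ℝ → ℝ}
    (H : ∀ T, 0 ≤ T → ∀ ε > 0, ∃ δ > 0, ∀ s u t, 0 ≤ s → s ≤ u → u ≤ t → t ≤ T → t - s ≤ δ →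
      |f t - f s - (t - s) * Φ u| ≤ (t - s) * ε) :
    (∀ t ∈ Set.Ici (0 : ℝ), HasDerivWithinAt f (Φ t) (Set.Ici 0) t) ∧
      ContinuousOn Φ (Set.Ici 0) := by
  constructor
  · intro t ht
    rw [hasDerivWithinAt_iff_isLittleO, Asymptotics.isLittleO_iff]
    intro ε hε
    obtain ⟨δ, hδ, hH⟩ := H (t + 1) (by linarith [Set.mem_Ici.1 ht]) ε hε
    have hnear : ∀ᶠ s in nhdsWithin t (Set.Ici 0), |s - t| < min δ 1 :=
      nhdsWithin_le_nhds (Metric.ball_mem_nhds t (lt_min hδ one_pos))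
    filter_upwards [hnear, self_mem_nhdsWithin] with s hs hs0
    have h1 := abs_lt.1 (hs.trans_le (min_le_left _ _))
    have h2 := abs_lt.1 (hs.trans_le (min_le_right _ _))
    simp only [Real.norm_eq_abs, smul_eq_mul]
    rcases le_total s t with hst | hst
    · have := hH s t t hs0 hst le_rfl (by linarith) (by linarith)
      rw [abs_sub_comm s t, abs_of_nonneg (sub_nonneg.2 hst), mul_comm ε]
      refine le_of_eq_of_le ?_ this
      rw [← abs_neg]
      ring_nf
    · have := hH t t s ht le_rfl hst (by linarith) (by linarith)
      rw [abs_of_nonneg (sub_nonneg.2 hst), mul_comm ε]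
      exact this
  · intro t ht
    rw [ContinuousWithinAt, Metric.tendsto_nhds]
    intro ε hε
    obtain ⟨δ, hδ, hH⟩ := H (t + 1) (by linarith [Set.mem_Ici.1 ht]) (ε / 4) (by positivity)
    have hnear : ∀ᶠ s in nhdsWithin t (Set.Ici 0), |s - t| < min δ 1 :=
      nhdsWithin_le_nhds (Metric.ball_mem_nhds t (lt_min hδ one_pos))
    have aux : ∀ a b, 0 ≤ a → a < b → b ≤ t + 1 → b - a ≤ δ → |Φ b - Φ a| < ε := by
      intro a b ha hab hb hba
      have h1 := abs_le.1 (hH a a b ha le_rfl hab.le hb hba)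
      have h2 := abs_le.1 (hH a b b ha hab.le le_rfl hb hba)
      have hpos := sub_pos.2 hab
      rw [abs_lt]
      constructor <;> nlinarith
    filter_upwards [hnear, self_mem_nhdsWithin] with s hs hs0
    have h1 := abs_lt.1 (hs.trans_le (min_le_left _ _))
    have h2 := abs_lt.1 (hs.trans_le (min_le_right _ _))
    rw [Real.dist_eq]
    rcases lt_trichotomy s t with hst | rfl | hst
    · rw [abs_sub_comm]
      exact aux s t hs0 hst (by linarith) (by linarith)
    · simpa using hε
    · exact aux t s ht hst (by linarith) (by linarith)

/-- Corollary 2.4: global classical solution conserving mass and number of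
particles; here `λ = max{μ,ν}` when `max{μ,ν} > 1` and `λ = 1` otherwise, i.e.
`λ = max (max μ ν) 1`. -/
theorem edg_global_classical_conservation (K : ℕ → ℕ → ℝ) (Cq μ ν : ℝ) (f0 : ℕ → ℝ)
    (hKnn : ∀ j k : ℕ, 0 ≤ K j k) (hKsym : ∀ j k : ℕ, K j k = K k j) (hCq : 0 < Cq)
    (hμ : μ ∈ Set.Icc (0:ℝ) 2) (hν : ν ∈ Set.Icc (0:ℝ) 2) (hμν : μ + ν ≤ 3)
    (hKle : ∀ j k : ℕ, K j k ≤ Cq * ((j : ℝ) ^ μ * (k : ℝ) ^ ν + (j : ℝ) ^ ν * (k : ℝ) ^ μ))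
    (hf0 : MemYplus (max (max μ ν) 1) f0) :
    ∃ f : ℝ → ℕ → ℝ, f 0 = f0 ∧
      (∀ t : ℝ, 0 ≤ t → MemYplus (max (max μ ν) 1) (f t)) ∧
      IsClassicalSolutionOn K f (Set.Ici 0) ∧
      (∀ t : ℝ, 0 ≤ t → mom 0 (f t) = mom 0 f0 ∧ mom 1 (f t) = mom 1 f0) := by
  obtain ⟨hμ0, hμ2⟩ := hμ
  obtain ⟨hν0, hν2⟩ := hν
  set r := max (max μ ν) 1 with hr_def
  have hr : 1 ≤ r := le_max_right _ _
  have hr2 : r ≤ 2 := max_le (max_le hμ2 hν2) one_le_two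
  have hμr : μ ≤ r := (le_max_left μ ν).trans (le_max_left _ _)
  have hνr : ν ≤ r := (le_max_right μ ν).trans (le_max_left _ _)
  have hdrift := fun n j k (hk : 1 ≤ k) => kernel_mul_second_diff_le hKnn hCq hμ2 hν2 hμν hKle
    hr hr2 hμr hνr n j hk
  have hK := kernel_le_sizeWeight hCq hμ0 hν0 hμr hνr hKle
  obtain ⟨hf0nn, hf0s⟩ := hf0
  have hf0sum : Summable f0 := by
    refine (summable_nat_add_iff 1).1 (Summable.of_nonneg_of_le (fun k => hf0nn _) (fun k => ?_)
      ((summable_nat_add_iff 1).2 hf0s))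
    exact le_mul_of_one_le_left (hf0nn _)
      (Real.one_le_rpow (by exact_mod_cast Nat.le_add_left 1 k) (by linarith))
  have h0 : Tame r f0 1 f0 := by
    refine ⟨hf0nn, ?_, fun n => by rw [one_mul]⟩
    simpa only [sizeWeight, add_mul, one_mul] using hf0sum.add hf0s
  have hf : ∀ t, 0 ≤ t → Conserving r f0 _ (edgLimit K f0 t) := fun t ht =>
    (conserving_edgLimit hKnn hKsym hr (by positivity) hdrift h0 ht).1
  have hC1 := fun j => hasDerivWithinAt_and_continuousOn_of_first_order fun T hT ε hε =>
    exists_abs_edgLimit_sub_le hKnn hKsym hr (by positivity) hdrift (by positivity) hK h0 hT j hε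
  refine ⟨edgLimit K f0, edgLimit_zero K f0, fun t ht => ⟨(hf t ht).nonneg, ?_⟩,
    ⟨fun t ht j => ?_, fun t ht j => (hC1 j).1 t ht, fun j => (hC1 j).2⟩, fun t ht => ⟨?_, ?_⟩⟩
  · exact summable_mul_of_le (fun k => by positivity)
      (fun k => rpow_le_sizeWeight (by linarith) le_rfl k) (hf t ht).nonneg (hf t ht).summable
  · have hs := (hf t ht).toTame.summable_kernel hKnn hK j
    refine ⟨hs, ?_⟩
    simpa only [hKsym j] using (summable_nat_add_iff 1).2 hs
  · simpa [mom] using (hf t ht).number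
  · simpa [mom] using (hf t ht).mass
end

section
/- Let 1 < α ≤ 2 and let K : ℕ₀×ℕ₀ → [0,∞) be a symmetric kernel satisfying C_1 (j² k^α + j^α k²) ≤ K_{j,k} ≤ C j² k² for all j,k ∈ ℕ₀, where C, C_1 > 0. Assume f(0) = (f_j(0))_{j≥0} ∈ Y_{2+α}^+ with M_α(f(0)) > 0. Then there is no global mass-conserving solution f = (f_j)_{j≥0} of the EDG system on [0,∞) with f(t) ∈ Y_2^+ for all t ≥ 0, i.e. no such solution with M_1(f(t)) = M_1(f(0)) and M_2(f(t)) < ∞ for all t ∈ (0,∞). -/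
open MeasureTheory Filter

theorem rpow_secondDiff_ge {α x : ℝ} (hα : 1 < α) (hα2 : α ≤ 2) (hx : 1 ≤ x) :
    α * (α - 1) / 2 * x ^ (α - 2) ≤ (x + 1) ^ α - 2 * x ^ α + (x - 1) ^ α := by
  set k : ℝ := α * (α - 1) * (x + 1) ^ (α - 2) with hk
  have hconv : ConvexOn ℝ (Set.Icc 0 (x + 1)) (fun u : ℝ => u ^ α - k / 2 * u ^ 2) := by
    refine convexOn_of_hasDerivWithinAt2_nonneg (convex_Icc _ _)
      (f' := fun u => α * u ^ (α - 1) - k * u)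
      (f'' := fun u => α * ((α - 1) * u ^ (α - 2)) - k) ?_ ?_ ?_ ?_
    · refine ContinuousOn.sub ?_ (by fun_prop)
      exact (Real.continuous_rpow_const (by linarith)).continuousOn
    · intro u hu
      rw [interior_Icc] at hu
      have h1 := Real.hasDerivAt_rpow_const (x := u) (p := α) (Or.inl hu.1.ne')
      have h2 := ((hasDerivAt_id u).pow 2).const_mul (k / 2)
      refine ((h1.sub h2).congr_deriv ?_).hasDerivWithinAt
      simp
      ring
    · intro u hu
      rw [interior_Icc] at hu
      have h1 := (Real.hasDerivAt_rpow_const (x := u) (p := α - 1)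
        (Or.inl hu.1.ne')).const_mul α
      have h2 := (hasDerivAt_id u).const_mul k
      refine ((h1.sub h2).congr_deriv ?_).hasDerivWithinAt
      rw [show α - 1 - 1 = α - 2 by ring]
      simp
    · intro u hu
      rw [interior_Icc] at hu
      have h1 : (x + 1) ^ (α - 2) ≤ u ^ (α - 2) :=
        Real.rpow_le_rpow_of_nonpos hu.1 hu.2.le (by linarith)
      have h2 : 0 ≤ α * (α - 1) := mul_nonneg (by linarith) (by linarith)
      have := mul_le_mul_of_nonneg_left h1 h2
      simp only [hk]
      linarith
  have hmem1 : x + 1 ∈ Set.Icc 0 (x + 1) := ⟨by linarith, le_rfl⟩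
  have hmem2 : x - 1 ∈ Set.Icc 0 (x + 1) := ⟨by linarith, by linarith⟩
  have hhalf : (0 : ℝ) ≤ 1 / 2 := by norm_num
  have hmid := hconv.2 hmem1 hmem2 hhalf hhalf (by norm_num)
  simp only [smul_eq_mul] at hmid
  rw [show 1 / 2 * (x + 1) + 1 / 2 * (x - 1) = x by ring] at hmid
  have hk2 : α * (α - 1) / 2 * x ^ (α - 2) ≤ k := by
    have h1 : (2 * x) ^ (α - 2) ≤ (x + 1) ^ (α - 2) :=
      Real.rpow_le_rpow_of_nonpos (by linarith) (by linarith) (by linarith)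
    rw [Real.mul_rpow (by norm_num) (by linarith)] at h1
    have h3 : (2 : ℝ) ^ (-1 : ℝ) ≤ 2 ^ (α - 2) :=
      Real.rpow_le_rpow_of_exponent_le (by norm_num) (by linarith)
    rw [Real.rpow_neg_one] at h3
    have h4 : 0 ≤ x ^ (α - 2) := Real.rpow_nonneg (by linarith) _
    have h2 : 0 ≤ α * (α - 1) := mul_nonneg (by linarith) (by linarith)
    have h5 := mul_le_mul_of_nonneg_left ((mul_le_mul_of_nonneg_right h3 h4).trans h1) h2
    rw [hk]
    linarith
  nlinarith [hmid, hk2]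

theorem sum_range_mul_secondDiff {R : Type*} [CommRing R] (ψ G : ℕ → R) (hψ : ψ 0 = 0)
    (hG : G 0 = 0) (n : ℕ) :
    ∑ i ∈ Finset.range n, ψ (i + 1) * (G (i + 2) - 2 * G (i + 1) + G i) =
      ∑ i ∈ Finset.range n, G (i + 1) * (ψ (i + 2) - 2 * ψ (i + 1) + ψ i)
        + (ψ n * G (n + 1) - ψ (n + 1) * G n) := by
  induction n with
  | zero => simp [hψ, hG]
  | succ n ih =>
    rw [Finset.sum_range_succ, Finset.sum_range_succ, ih]
    ring

/-- The function `j ↦ j ^ α`, continued beyond `L` by the line through the origin. -/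
noncomputable def truncPow (α : ℝ) (L j : ℕ) : ℝ := (j : ℝ) * ((min j L : ℕ) : ℝ) ^ (α - 1)

theorem truncPow_of_le {α : ℝ} (hα : 1 < α) {L j : ℕ} (h : j ≤ L) :
    truncPow α L j = (j : ℝ) ^ α := by
  rw [truncPow, min_eq_left h]
  rcases Nat.eq_zero_or_pos j with rfl | hj
  · simp [Real.zero_rpow (show α ≠ 0 by linarith)]
  · have hj' : (0 : ℝ) < j := by exact_mod_cast hj
    rw [Real.rpow_sub_one hj'.ne']
    field_simp

theorem truncPow_of_ge {α : ℝ} {L j : ℕ} (h : L ≤ j) :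
    truncPow α L j = (j : ℝ) * (L : ℝ) ^ (α - 1) := by
  rw [truncPow, min_eq_right h]

theorem truncPow_nonneg (α : ℝ) (L j : ℕ) : 0 ≤ truncPow α L j := by
  unfold truncPow
  positivity

theorem truncPow_le {α : ℝ} (hα : 1 < α) (L j : ℕ) : truncPow α L j ≤ (j : ℝ) ^ α := by
  rw [← truncPow_of_le hα le_rfl, truncPow, truncPow, min_self]
  have hmin : ((min j L : ℕ) : ℝ) ≤ j := by exact_mod_cast min_le_left j L
  exact mul_le_mul_of_nonneg_left
    (Real.rpow_le_rpow (Nat.cast_nonneg _) hmin (by linarith)) (Nat.cast_nonneg _)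

theorem truncPow_secondDiff_ge_of_lt {α : ℝ} (hα : 1 < α) (hα2 : α ≤ 2) {L i : ℕ}
    (h : i + 2 ≤ L) :
    α * (α - 1) / 2 * ((i + 1 : ℕ) : ℝ) ^ (α - 2) ≤
      truncPow α L (i + 2) - 2 * truncPow α L (i + 1) + truncPow α L i := by
  rw [truncPow_of_le hα h, truncPow_of_le hα (by omega), truncPow_of_le hα (by omega)]
  have := rpow_secondDiff_ge hα hα2 (x := ((i + 1 : ℕ) : ℝ)) (by simp)
  convert this using 4 <;> push_cast <;> ring

theorem truncPow_secondDiff_ge_at {α : ℝ} (hα : 1 < α) (hα2 : α ≤ 2) (N : ℕ) :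
    -((N + 1 : ℕ) : ℝ) ≤ truncPow α (N + 1) (N + 2) - 2 * truncPow α (N + 1) (N + 1)
      + truncPow α (N + 1) N := by
  rw [truncPow_of_ge (Nat.le_succ (N + 1)), truncPow_of_ge le_rfl,
    truncPow_of_le hα (Nat.le_succ N)]
  set x : ℝ := ((N + 1 : ℕ) : ℝ) with hx
  have hx1 : 1 ≤ x := by simp [hx]
  have hx0 : 0 < x := by linarith
  have hN : (N : ℝ) = x * (1 + -(1 / x)) := by
    rw [hx]; push_cast; field_simp; ring
  have hN2 : ((N + 2 : ℕ) : ℝ) = x + 1 := by rw [hx]; push_cast; ring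
  have hinv : 1 / x ≤ 1 := by rw [div_le_one hx0]; exact hx1
  have hb := one_add_mul_self_le_rpow_one_add (s := -(1 / x)) (by linarith) hα.le
  have hxa : x ^ α = x * x ^ (α - 1) := by
    rw [Real.rpow_sub_one hx0.ne']; field_simp
  have hle : x ^ (α - 1) ≤ x := by
    calc x ^ (α - 1) ≤ x ^ (1 : ℝ) := Real.rpow_le_rpow_of_exponent_le hx1 (by linarith)
      _ = x := Real.rpow_one x
  have hp : 0 ≤ x ^ (α - 1) := by positivity
  have hlow : x * x ^ (α - 1) - α * x ^ (α - 1) ≤ (N : ℝ) ^ α := by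
    rw [hN, Real.mul_rpow hx0.le (by linarith)]
    calc x * x ^ (α - 1) - α * x ^ (α - 1) = x ^ α * (1 + α * -(1 / x)) := by
          rw [hxa]; field_simp; ring
      _ ≤ _ := by gcongr
  rw [hN2]
  nlinarith

theorem exists_nat_mul_lt_of_summable {a : ℕ → ℝ} (ha : Summable a) {ε : ℝ} (hε : 0 < ε)
    (n : ℕ) : ∃ N ≥ n, ((N + 1 : ℕ) : ℝ) * a N < ε := by
  by_contra! h
  refine Real.not_summable_natCast_inv ((summable_nat_add_iff (n + 1)).1 ?_)
  refine Summable.of_nonneg_of_le (fun i => by positivity) (fun i => ?_)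
    (((summable_nat_add_iff n).2 ha).mul_left ε⁻¹)
  have hi := h (i + n) (by omega)
  have hpos : (0 : ℝ) < ((i + (n + 1) : ℕ) : ℝ) := by positivity
  rw [show i + n + 1 = i + (n + 1) by ring] at hi
  rw [inv_eq_one_div, div_le_iff₀ hpos, inv_mul_eq_div, div_mul_eq_mul_div, le_div_iff₀ hε]
  linarith

/-- The `α`-th moment restricted to the indices `1, …, N`. -/
noncomputable def partialMom (α : ℝ) (N : ℕ) (g : ℕ → ℝ) : ℝ :=
  ∑ i ∈ Finset.range N, ((i + 1 : ℕ) : ℝ) ^ α * g (i + 1)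

theorem partialMom_nonneg (α : ℝ) (N : ℕ) {g : ℕ → ℝ} (hg : ∀ j, 0 ≤ g j) :
    0 ≤ partialMom α N g :=
  Finset.sum_nonneg fun i _ => mul_nonneg (by positivity) (hg _)

theorem partialMom_mono (α : ℝ) {g : ℕ → ℝ} (hg : ∀ j, 0 ≤ g j) :
    Monotone fun N => partialMom α N g := by
  intro m n hmn
  exact Finset.sum_le_sum_of_subset_of_nonneg (Finset.range_mono hmn)
    fun i _ _ => mul_nonneg (by positivity) (hg _)

theorem hasSum_rpow_mul_succ {α : ℝ} (hα : 1 < α) {g : ℕ → ℝ}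
    (hs : Summable fun j : ℕ => (j : ℝ) ^ α * g j) :
    HasSum (fun i : ℕ => ((i + 1 : ℕ) : ℝ) ^ α * g (i + 1)) (mom α g) := by
  have h := (hasSum_nat_add_iff' (f := fun j : ℕ => (j : ℝ) ^ α * g j) 1).2 hs.hasSum
  simpa [Real.zero_rpow (show α ≠ 0 by linarith), mom] using h

theorem tendsto_partialMom {α : ℝ} (hα : 1 < α) {g : ℕ → ℝ}
    (hs : Summable fun j : ℕ => (j : ℝ) ^ α * g j) :
    Tendsto (fun N => partialMom α N g) atTop (nhds (mom α g)) :=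
  (hasSum_rpow_mul_succ hα hs).tendsto_sum_nat

theorem partialMom_le_mom {α : ℝ} (hα : 1 < α) (N : ℕ) {g : ℕ → ℝ} (hg : ∀ j, 0 ≤ g j)
    (hs : Summable fun j : ℕ => (j : ℝ) ^ α * g j) : partialMom α N g ≤ mom α g :=
  sum_le_hasSum _ (fun _ _ => mul_nonneg (by positivity) (hg _)) (hasSum_rpow_mul_succ hα hs)

theorem MemYplus.summable_of_le {r p : ℝ} (hp : 0 < p) (hpr : p ≤ r) {g : ℕ → ℝ}
    (hg : MemYplus r g) : Summable fun j : ℕ => (j : ℝ) ^ p * g j := by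
  refine Summable.of_nonneg_of_le (fun j => mul_nonneg (by positivity) (hg.1 j)) (fun j => ?_) hg.2
  refine mul_le_mul_of_nonneg_right ?_ (hg.1 j)
  rcases Nat.eq_zero_or_pos j with rfl | hj
  · simp [Real.zero_rpow hp.ne', Real.zero_rpow (hp.trans_le hpr).ne']
  · exact Real.rpow_le_rpow_of_exponent_le (by exact_mod_cast hj) hpr

theorem MemYplus.mom_le {r p : ℝ} (hp : 0 < p) (hpr : p ≤ r) {g : ℕ → ℝ}
    (hg : MemYplus r g) : mom p g ≤ mom r g := by
  refine (hg.summable_of_le hp hpr).tsum_le_tsum (fun j => ?_) hg.2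
  refine mul_le_mul_of_nonneg_right ?_ (hg.1 j)
  rcases Nat.eq_zero_or_pos j with rfl | hj
  · simp [Real.zero_rpow hp.ne', Real.zero_rpow (hp.trans_le hpr).ne']
  · exact Real.rpow_le_rpow_of_exponent_le (by exact_mod_cast hj) hpr

theorem hasSum_truncPow_mul {α : ℝ} (L : ℕ) {g : ℕ → ℝ}
    (h1 : Summable fun j : ℕ => (j : ℝ) ^ (1 : ℝ) * g j) :
    HasSum (fun j => truncPow α L j * g j)
      (∑ i ∈ Finset.range L,
          (truncPow α L (i + 1) - (L : ℝ) ^ (α - 1) * ((i + 1 : ℕ) : ℝ)) * g (i + 1)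
        + (L : ℝ) ^ (α - 1) * mom 1 g) := by
  have hfin : HasSum (fun j => (truncPow α L j - (L : ℝ) ^ (α - 1) * (j : ℝ)) * g j)
      (∑ j ∈ Finset.range (L + 1), (truncPow α L j - (L : ℝ) ^ (α - 1) * (j : ℝ)) * g j) := by
    refine hasSum_sum_of_ne_finset_zero fun j hj => ?_
    rw [Finset.mem_range, not_lt] at hj
    rw [truncPow_of_ge (by omega)]
    ring
  rw [Finset.sum_range_succ'] at hfin
  have hlin := h1.hasSum.mul_left ((L : ℝ) ^ (α - 1))
  convert hfin.add hlin using 1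
  · funext j
    rw [Real.rpow_one]
    ring
  · simp [truncPow, mom]

theorem sum_mul_sub_eq_integral {f G : ℝ → ℕ → ℝ} {s t : ℝ}
    (hGint : ∀ j, IntervalIntegrable (fun u => G u j) volume s t)
    (hG0 : ∀ u, G u 0 = 0)
    (heq : ∀ m, f t (m + 1) - f s (m + 1)
      = ∫ u in s..t, (G u (m + 2) - 2 * G u (m + 1) + G u m))
    {ψ : ℕ → ℝ} {L : ℕ} (hψ0 : ψ 0 = 0) (hψL : ψ L = 0) (hψL1 : ψ (L + 1) = 0) :
    ∑ i ∈ Finset.range L, ψ (i + 1) * (f t (i + 1) - f s (i + 1)) =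
      ∫ u in s..t, ∑ i ∈ Finset.range L, G u (i + 1) * (ψ (i + 2) - 2 * ψ (i + 1) + ψ i) := by
  simp_rw [heq, ← intervalIntegral.integral_const_mul]
  rw [← intervalIntegral.integral_finsetSum]
  · refine intervalIntegral.integral_congr fun u _ => ?_
    rw [sum_range_mul_secondDiff ψ (G u) hψ0 (hG0 u) L, hψL, hψL1]
    ring
  · intro i _
    exact (((hGint _).sub ((hGint _).const_mul 2)).add (hGint _)).const_mul _

theorem partialMom_sq_le_sum {α D c1 : ℝ} (hα : 1 < α) (hα2 : α ≤ 2) {g A : ℕ → ℝ}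
    (hlow : ∀ j n : ℕ, c1 * ((j : ℝ) ^ 2 * partialMom α n g) * g j ≤ A j)
    (hA : ∀ j, 0 ≤ A j) (hup : ∀ j : ℕ, A j ≤ D * ((j : ℝ) ^ 2 * g j)) (N : ℕ) :
    α * (α - 1) / 2 * c1 * partialMom α N g ^ 2
        - D * ((N + 1 : ℕ) : ℝ) * (((N + 1 : ℕ) : ℝ) ^ 2 * g (N + 1)) ≤
      ∑ i ∈ Finset.range (N + 1), A (i + 1) * (truncPow α (N + 1) (i + 2)
        - 2 * truncPow α (N + 1) (i + 1) + truncPow α (N + 1) i) := by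
  rw [Finset.sum_range_succ, sub_eq_add_neg]
  have hα0 : 0 ≤ α * (α - 1) / 2 := by nlinarith
  refine add_le_add ?_ ?_
  · have hsq : α * (α - 1) / 2 * c1 * partialMom α N g ^ 2 =
        ∑ i ∈ Finset.range N, α * (α - 1) / 2 * c1 * partialMom α N g *
          (((i + 1 : ℕ) : ℝ) ^ α * g (i + 1)) := by
      rw [← Finset.mul_sum, ← partialMom]; ring
    rw [hsq]
    refine Finset.sum_le_sum fun i hi => ?_
    rw [Finset.mem_range] at hi
    have hx : (0 : ℝ) < ((i + 1 : ℕ) : ℝ) := by positivity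
    have hxα : ((i + 1 : ℕ) : ℝ) ^ α = ((i + 1 : ℕ) : ℝ) ^ 2 * ((i + 1 : ℕ) : ℝ) ^ (α - 2) := by
      rw [← Real.rpow_natCast, ← Real.rpow_add hx]; norm_num
    calc _ = (c1 * (((i + 1 : ℕ) : ℝ) ^ 2 * partialMom α N g) * g (i + 1)) *
          (α * (α - 1) / 2 * ((i + 1 : ℕ) : ℝ) ^ (α - 2)) := by rw [hxα]; ring
      _ ≤ A (i + 1) * (α * (α - 1) / 2 * ((i + 1 : ℕ) : ℝ) ^ (α - 2)) :=
          mul_le_mul_of_nonneg_right (hlow _ _) (by positivity)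
      _ ≤ _ := mul_le_mul_of_nonneg_left
          (truncPow_secondDiff_ge_of_lt hα hα2 (by omega)) (hA _)
  · have h1 := mul_le_mul_of_nonneg_left (truncPow_secondDiff_ge_at hα hα2 N) (hA (N + 1))
    have h2 := mul_le_mul_of_nonneg_right (hup (N + 1)) (Nat.cast_nonneg (α := ℝ) (N + 1))
    linarith

theorem summable_integral_of_sum_le {a : ℝ → ℕ → ℝ} {s t B : ℝ} (hst : s ≤ t)
    (ha : ∀ j, ContinuousOn (fun u => a u j) (Set.Icc s t))
    (hnn : ∀ u ∈ Set.Icc s t, ∀ j, 0 ≤ a u j)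
    (hB : ∀ u ∈ Set.Icc s t, ∀ n, ∑ j ∈ Finset.range n, a u j ≤ B) :
    Summable fun j => ∫ u in s..t, a u j := by
  have hint : ∀ j, IntervalIntegrable (fun u => a u j) volume s t := fun j =>
    (ha j).intervalIntegrable_of_Icc hst
  refine summable_of_sum_range_le (c := (t - s) * B)
    (fun j => intervalIntegral.integral_nonneg hst fun u hu => hnn u hu j) fun n => ?_
  rw [← intervalIntegral.integral_finsetSum fun j _ => hint j]
  calc _ ≤ ∫ _ in s..t, B := by
        refine intervalIntegral.integral_mono_on hst ?_ (by simp) fun u hu => hB u hu n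
        exact (continuousOn_finsetSum _ fun j _ => ha j).intervalIntegrable_of_Icc hst
    _ = _ := by simp

theorem partialMom_add_integral_le_mom {α D c1 B : ℝ} (hα : 1 < α) (hα2 : α ≤ 2)
    (hc1 : 0 ≤ c1) (hD : 0 < D) {f G : ℝ → ℕ → ℝ} {s t : ℝ} (hst : s ≤ t)
    (hY : ∀ u ∈ Set.Icc s t, MemYplus 2 (f u))
    (hcont : ∀ j, ContinuousOn (fun u => f u j) (Set.Icc s t))
    (hB : ∀ u ∈ Set.Icc s t, mom 2 (f u) ≤ B)
    (hmass : mom 1 (f t) = mom 1 (f s))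
    (hGint : ∀ j, IntervalIntegrable (fun u => G u j) volume s t)
    (hG0 : ∀ u, G u 0 = 0)
    (heq : ∀ m, f t (m + 1) - f s (m + 1)
      = ∫ u in s..t, (G u (m + 2) - 2 * G u (m + 1) + G u m))
    (hGnn : ∀ u ∈ Set.Icc s t, ∀ j, 0 ≤ G u j)
    (hlow : ∀ u ∈ Set.Icc s t, ∀ j n : ℕ,
      c1 * ((j : ℝ) ^ 2 * partialMom α n (f u)) * f u j ≤ G u j)
    (hup : ∀ u ∈ Set.Icc s t, ∀ j : ℕ, G u j ≤ D * ((j : ℝ) ^ 2 * f u j)) (n : ℕ) :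
    partialMom α n (f s) + α * (α - 1) / 2 * c1 * ∫ u in s..t, partialMom α n (f u) ^ 2
      ≤ mom α (f t) := by
  have hs : s ∈ Set.Icc s t := ⟨le_rfl, hst⟩
  have ht : t ∈ Set.Icc s t := ⟨hst, le_rfl⟩
  have hα0 : 0 ≤ α * (α - 1) / 2 * c1 := mul_nonneg (by nlinarith) hc1
  have hcS : ∀ N, ContinuousOn (fun u => partialMom α N (f u)) (Set.Icc s t) := fun N =>
    continuousOn_finsetSum _ fun i _ => continuousOn_const.mul (hcont _)
  set a : ℕ → ℝ := fun N => ∫ u in s..t, ((N + 1 : ℕ) : ℝ) ^ 2 * f u (N + 1) with ha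
  have hcf : ∀ N : ℕ, ContinuousOn (fun u => ((N + 1 : ℕ) : ℝ) ^ 2 * f u (N + 1))
      (Set.Icc s t) := fun N => continuousOn_const.mul (hcont _)
  have hasum : Summable a := by
    refine summable_integral_of_sum_le (B := B) hst hcf
      (fun u hu j => mul_nonneg (by positivity) ((hY u hu).1 _)) fun u hu N => ?_
    have h := partialMom_le_mom (α := 2) (by norm_num) N (hY u hu).1 (hY u hu).2
    simp only [partialMom, Real.rpow_two] at h
    exact h.trans (hB u hu)
  refine le_of_forall_pos_lt_add fun ε hε => ?_
  obtain ⟨N, hnN, hN⟩ := exists_nat_mul_lt_of_summable hasum (div_pos hε hD) n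
  set w : ℝ := ((N + 1 : ℕ) : ℝ) ^ (α - 1) with hw
  set ψ : ℕ → ℝ := fun j => truncPow α (N + 1) j - w * (j : ℝ) with hψ
  have hψ0 : ψ 0 = 0 := by simp [hψ, truncPow]
  have hψge : ∀ j, N + 1 ≤ j → ψ j = 0 := fun j hj => by
    simp only [hψ, hw]; rw [truncPow_of_ge hj]; ring
  have hdisc := sum_mul_sub_eq_integral hGint hG0 heq hψ0 (hψge (N + 1) le_rfl)
    (hψge (N + 1 + 1) (by omega))
  have hint : ∫ u in s..t, (α * (α - 1) / 2 * c1 * partialMom α n (f u) ^ 2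
        - D * ((N + 1 : ℕ) : ℝ) * (((N + 1 : ℕ) : ℝ) ^ 2 * f u (N + 1))) ≤
      ∫ u in s..t, ∑ i ∈ Finset.range (N + 1),
        G u (i + 1) * (ψ (i + 2) - 2 * ψ (i + 1) + ψ i) := by
    refine intervalIntegral.integral_mono_on hst ?_ ?_ fun u hu => ?_
    · refine ContinuousOn.intervalIntegrable_of_Icc hst ?_
      exact (continuousOn_const.mul ((hcS n).pow 2)).sub (continuousOn_const.mul (hcf N))
    · have := IntervalIntegrable.sum (μ := volume) (a := s) (b := t) (Finset.range (N + 1))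
        (f := fun i u => G u (i + 1) * (ψ (i + 2) - 2 * ψ (i + 1) + ψ i))
        fun i _ => (hGint (i + 1)).mul_const _
      exact this.congr (fun u _ => by simp)
    · have h1 := partialMom_sq_le_sum hα hα2 (hlow u hu) (hGnn u hu) (hup u hu) N
      have h2 : ∀ i : ℕ, ψ (i + 2) - 2 * ψ (i + 1) + ψ i = truncPow α (N + 1) (i + 2)
          - 2 * truncPow α (N + 1) (i + 1) + truncPow α (N + 1) i := fun i => by
        simp only [hψ]; push_cast; ring
      simp_rw [h2]
      refine le_trans ?_ h1
      have h3 : partialMom α n (f u) ^ 2 ≤ partialMom α N (f u) ^ 2 :=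
        pow_le_pow_left₀ (partialMom_nonneg _ _ (hY u hu).1)
          (partialMom_mono α (hY u hu).1 hnN) 2
      have := mul_le_mul_of_nonneg_left h3 hα0
      linarith
  rw [intervalIntegral.integral_sub, intervalIntegral.integral_const_mul,
    intervalIntegral.integral_const_mul, ← hdisc] at hint
  rotate_left
  · exact ContinuousOn.intervalIntegrable_of_Icc hst (continuousOn_const.mul ((hcS n).pow 2))
  · exact ContinuousOn.intervalIntegrable_of_Icc hst (continuousOn_const.mul (hcf N))
  have hmt := hasSum_truncPow_mul (α := α) (N + 1)
    ((hY t ht).summable_of_le one_pos (by norm_num))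
  have hms := hasSum_truncPow_mul (α := α) (N + 1)
    ((hY s hs).summable_of_le one_pos (by norm_num))
  have hupper := hasSum_le (fun j => mul_le_mul_of_nonneg_right (truncPow_le hα (N + 1) j)
    ((hY t ht).1 j)) hmt ((hY t ht).summable_of_le (by linarith) hα2).hasSum
  have hlower : partialMom α n (f s) ≤ _ :=
    le_trans ?_ (sum_le_hasSum (Finset.range (n + 1))
      (fun j _ => mul_nonneg (truncPow_nonneg α (N + 1) j) ((hY s hs).1 j)) hms)
  swap
  · rw [Finset.sum_range_succ', partialMom]
    refine le_add_of_le_of_nonneg (Finset.sum_le_sum fun i hi => ?_)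
      (mul_nonneg (truncPow_nonneg _ _ _) ((hY s hs).1 0))
    rw [Finset.mem_range] at hi
    rw [truncPow_of_le hα (by omega)]
  have herr : D * (((N + 1 : ℕ) : ℝ) * a N) < ε := by
    rw [lt_div_iff₀ hD] at hN; linarith
  simp only [mul_sub, Finset.sum_sub_distrib] at hint
  change _ ≤ mom α (f t) at hupper
  rw [hmass] at hupper
  simp only [hψ] at hint
  linarith

theorem mom_add_mul_sq_le {α c : ℝ} (hα : 1 < α) (hc : 0 < c) {f : ℝ → ℕ → ℝ}
    (hnn : ∀ t, 0 ≤ t → ∀ j, 0 ≤ f t j)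
    (hs : ∀ t, 0 ≤ t → Summable fun j : ℕ => (j : ℝ) ^ α * f t j)
    (hcont : ∀ j, ContinuousOn (fun t => f t j) (Set.Ici 0))
    (h : ∀ s t, 0 ≤ s → s ≤ t → ∀ n,
      partialMom α n (f s) + c * ∫ u in s..t, partialMom α n (f u) ^ 2 ≤ mom α (f t))
    {s t : ℝ} (hs0 : 0 ≤ s) (hst : s ≤ t) :
    mom α (f s) + c * ((t - s) * mom α (f s) ^ 2) ≤ mom α (f t) := by
  have hmono : ∀ u, s ≤ u → mom α (f s) ≤ mom α (f u) := fun u hu =>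
    le_of_tendsto' (tendsto_partialMom hα (hs s hs0)) fun n => by
      have h0 : 0 ≤ ∫ v in s..u, partialMom α n (f v) ^ 2 :=
        intervalIntegral.integral_nonneg hu fun v _ => sq_nonneg _
      have := h s u hs0 hu n
      nlinarith
  have hm : 0 ≤ mom α (f s) := tsum_nonneg fun j => mul_nonneg (by positivity) (hnn s hs0 j)
  have hcS : ∀ n, ContinuousOn (fun u => partialMom α n (f u)) (Set.Icc s t) := fun n =>
    continuousOn_finsetSum _ fun i _ => continuousOn_const.mul
      ((hcont _).mono fun u hu => hs0.trans hu.1)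
  have hcmin : ∀ n, ContinuousOn (fun u => min (partialMom α n (f u)) (mom α (f s)) ^ 2)
      (Set.Icc s t) := fun n => ((hcS n).inf continuousOn_const).pow 2
  have hlim : Tendsto
      (fun n => ∫ u in s..t, min (partialMom α n (f u)) (mom α (f s)) ^ 2) atTop
      (nhds (∫ _ in s..t, mom α (f s) ^ 2)) := by
    refine intervalIntegral.tendsto_integral_filter_of_dominated_convergence
      (fun _ => mom α (f s) ^ 2) ?_ ?_ (by simp) ?_
    · refine Eventually.of_forall fun n => ?_
      rw [Set.uIoc_of_le hst]
      exact ((hcmin n).mono Set.Ioc_subset_Icc_self).aestronglyMeasurable measurableSet_Ioc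
    · refine Eventually.of_forall fun n => Eventually.of_forall fun u hu => ?_
      rw [Set.uIoc_of_le hst] at hu
      rw [Real.norm_of_nonneg (sq_nonneg _)]
      exact pow_le_pow_left₀
        (le_min (partialMom_nonneg _ _ (hnn u (hs0.trans hu.1.le))) hm) (min_le_right _ _) 2
    · refine Eventually.of_forall fun u hu => ?_
      rw [Set.uIoc_of_le hst] at hu
      have h1 := ((tendsto_partialMom hα (hs u (hs0.trans hu.1.le))).min
        (tendsto_const_nhds (x := mom α (f s)))).pow 2
      rwa [min_eq_right (hmono u hu.1.le)] at h1
  rw [intervalIntegral.integral_const, smul_eq_mul] at hlim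
  refine le_of_tendsto' ((tendsto_partialMom hα (hs s hs0)).add (hlim.const_mul c)) fun n => ?_
  refine le_trans ?_ (h s t hs0 hst n)
  have hle : ∫ u in s..t, min (partialMom α n (f u)) (mom α (f s)) ^ 2 ≤
      ∫ u in s..t, partialMom α n (f u) ^ 2 := by
    refine intervalIntegral.integral_mono_on hst ((hcmin n).intervalIntegrable_of_Icc hst)
      (((hcS n).pow 2).intervalIntegrable_of_Icc hst) fun u hu => ?_
    exact pow_le_pow_left₀
      (le_min (partialMom_nonneg _ _ (hnn u (hs0.trans hu.1))) hm) (min_le_left _ _) 2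
  have := mul_le_mul_of_nonneg_left hle hc.le
  linarith

theorem exists_lt_of_add_mul_sq_le {M : ℝ → ℝ} {c : ℝ} (hc : 0 < c) (hM : 0 < M 0)
    (h : ∀ s t, 0 ≤ s → s ≤ t → M s + c * ((t - s) * M s ^ 2) ≤ M t) (B : ℝ) :
    ∃ t ∈ Set.Ico 0 (2 / (c * M 0)), B < M t := by
  have key : ∀ n : ℕ, ∃ t, 0 ≤ t ∧ t ≤ 2 / (c * M 0) * (1 - 1 / 2 ^ n) ∧ 2 ^ n * M 0 ≤ M t := by
    intro n
    induction n with
    | zero => exact ⟨0, by simp⟩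
    | succ n ih =>
      obtain ⟨t, ht0, ht, hMt⟩ := ih
      have hp : (0 : ℝ) < 2 ^ n := by positivity
      have hd : 0 < 1 / (c * (2 ^ n * M 0)) := by positivity
      refine ⟨t + 1 / (c * (2 ^ n * M 0)), by positivity, ?_, ?_⟩
      · refine (add_le_add_left ht _).trans (le_of_eq ?_)
        rw [pow_succ]
        field_simp
        ring
      · refine le_trans ?_ (h t (t + 1 / (c * (2 ^ n * M 0))) ht0 (by linarith))
        have hpos : 0 < 2 ^ n * M 0 := by positivity
        have hsq : (2 ^ n * M 0) ^ 2 ≤ M t ^ 2 := pow_le_pow_left₀ hpos.le hMt 2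
        have : c * ((t + 1 / (c * (2 ^ n * M 0)) - t) * M t ^ 2) = M t ^ 2 / (2 ^ n * M 0) := by
          field_simp
          ring
        rw [this]
        have : 2 ^ n * M 0 ≤ M t ^ 2 / (2 ^ n * M 0) := by
          rw [le_div_iff₀ hpos]; linarith
        rw [pow_succ]
        linarith
  obtain ⟨n, hn⟩ := pow_unbounded_of_one_lt (B / M 0) (one_lt_two (α := ℝ))
  obtain ⟨t, ht0, ht, hMt⟩ := key n
  refine ⟨t, ⟨ht0, ht.trans_lt ?_⟩, lt_of_lt_of_le ?_ hMt⟩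
  · have h1 : 0 < 2 / (c * M 0) := by positivity
    have h2 : (0 : ℝ) < 1 / 2 ^ n := by positivity
    nlinarith
  · rwa [div_lt_iff₀ hM] at hn

/-- The total rate `f_j ∑ₖ K_{j,k} f_k` at which clusters of size `j` take part in exchanges. -/
noncomputable def exchangeRate (K : ℕ → ℕ → ℝ) (g : ℕ → ℝ) (j : ℕ) : ℝ :=
  g j * ∑' k : ℕ, K j k * g k

section Kernel

variable {α C C1 : ℝ} {K : ℕ → ℕ → ℝ}

theorem kernel_nonneg (hC1 : 0 < C1)
    (hKge : ∀ j k : ℕ, C1 * ((j : ℝ) ^ 2 * (k : ℝ) ^ α + (j : ℝ) ^ α * (k : ℝ) ^ 2) ≤ K j k)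
    (j k : ℕ) : 0 ≤ K j k :=
  le_trans (by positivity) (hKge j k)

theorem kernel_zero_left (hC1 : 0 < C1)
    (hKge : ∀ j k : ℕ, C1 * ((j : ℝ) ^ 2 * (k : ℝ) ^ α + (j : ℝ) ^ α * (k : ℝ) ^ 2) ≤ K j k)
    (hKle : ∀ j k : ℕ, K j k ≤ C * (j : ℝ) ^ 2 * (k : ℝ) ^ 2) (k : ℕ) : K 0 k = 0 :=
  le_antisymm (by simpa using hKle 0 k) (kernel_nonneg hC1 hKge 0 k)

theorem tsum_kernel_succ (hC1 : 0 < C1) (hKsym : ∀ j k : ℕ, K j k = K k j)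
    (hKge : ∀ j k : ℕ, C1 * ((j : ℝ) ^ 2 * (k : ℝ) ^ α + (j : ℝ) ^ α * (k : ℝ) ^ 2) ≤ K j k)
    (hKle : ∀ j k : ℕ, K j k ≤ C * (j : ℝ) ^ 2 * (k : ℝ) ^ 2) {g : ℕ → ℝ} {j : ℕ}
    (hs : Summable fun k : ℕ => K j k * g k) :
    ∑' k : ℕ, K (k + 1) j * g (k + 1) = ∑' k : ℕ, K j k * g k := by
  rw [hs.tsum_eq_zero_add, hKsym j 0, kernel_zero_left hC1 hKge hKle, zero_mul, zero_add]
  simp_rw [hKsym j]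

theorem le_exchangeRate (hC1 : 0 < C1)
    (hKge : ∀ j k : ℕ, C1 * ((j : ℝ) ^ 2 * (k : ℝ) ^ α + (j : ℝ) ^ α * (k : ℝ) ^ 2) ≤ K j k)
    {g : ℕ → ℝ} (hg : ∀ j, 0 ≤ g j) {j : ℕ} (hs : Summable fun k : ℕ => K j k * g k) (n : ℕ) :
    C1 * ((j : ℝ) ^ 2 * partialMom α n g) * g j ≤ exchangeRate K g j := by
  rw [mul_comm, exchangeRate]
  refine mul_le_mul_of_nonneg_left ?_ (hg j)
  refine le_trans ?_ (sum_le_hasSum (Finset.range (n + 1))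
    (fun k _ => mul_nonneg (kernel_nonneg hC1 hKge j k) (hg k)) hs.hasSum)
  rw [Finset.sum_range_succ', partialMom, Finset.mul_sum, Finset.mul_sum]
  refine le_add_of_le_of_nonneg (Finset.sum_le_sum fun i _ => ?_)
    (mul_nonneg (kernel_nonneg hC1 hKge j 0) (hg 0))
  rw [← mul_assoc, ← mul_assoc]
  refine mul_le_mul_of_nonneg_right (le_trans ?_ (hKge j (i + 1))) (hg _)
  have : 0 ≤ C1 * ((j : ℝ) ^ α * ((i + 1 : ℕ) : ℝ) ^ 2) := by positivity
  linarith

theorem exchangeRate_le (hC : 0 < C)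
    (hKle : ∀ j k : ℕ, K j k ≤ C * (j : ℝ) ^ 2 * (k : ℝ) ^ 2) {g : ℕ → ℝ} {B : ℝ}
    (hg : MemYplus 2 g) (hB : mom 2 g ≤ B) {j : ℕ}
    (hs : Summable fun k : ℕ => K j k * g k) :
    exchangeRate K g j ≤ C * B * ((j : ℝ) ^ 2 * g j) := by
  have h1 : ∑' k : ℕ, K j k * g k ≤ C * (j : ℝ) ^ 2 * mom 2 g := by
    rw [mom, ← tsum_mul_left]
    refine hs.tsum_le_tsum (fun k => ?_) (hg.2.mul_left _)
    rw [Real.rpow_two, ← mul_assoc]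
    exact mul_le_mul_of_nonneg_right (hKle j k) (hg.1 k)
  have h2 : C * (j : ℝ) ^ 2 * mom 2 g ≤ C * (j : ℝ) ^ 2 * B :=
    mul_le_mul_of_nonneg_left hB (by positivity)
  calc exchangeRate K g j ≤ g j * (C * (j : ℝ) ^ 2 * B) :=
        mul_le_mul_of_nonneg_left (h1.trans h2) (hg.1 j)
    _ = _ := by ring

theorem IsMildSolutionOn.intervalIntegrable_exchangeRate {r T : ℝ} {f : ℝ → ℕ → ℝ}
    (hf : IsMildSolutionOn K r f (Set.Ico 0 T)) {s t : ℝ} (hs : 0 ≤ s) (hst : s ≤ t) (htT : t < T)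
    (j : ℕ) : IntervalIntegrable (fun u => exchangeRate K (f u) j) volume s t := by
  have hcont : ContinuousOn (fun u => f u j) (Set.Icc 0 t) :=
    (hf.2.1 j).mono fun u hu => ⟨hu.1, hu.2.trans_lt htT⟩
  have h := (hf.2.2.2.2.1 t ⟨hs.trans hst, htT⟩ j).continuousOn_mul hcont isCompact_Icc
  rw [intervalIntegrable_iff_integrableOn_Icc_of_le hst]
  exact h.mono_set (Set.Icc_subset_Icc_left hs)

theorem IsMildSolutionOn.sub_eq_integral (hC1 : 0 < C1) (hKsym : ∀ j k : ℕ, K j k = K k j)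
    (hKge : ∀ j k : ℕ, C1 * ((j : ℝ) ^ 2 * (k : ℝ) ^ α + (j : ℝ) ^ α * (k : ℝ) ^ 2) ≤ K j k)
    (hKle : ∀ j k : ℕ, K j k ≤ C * (j : ℝ) ^ 2 * (k : ℝ) ^ 2) {r T : ℝ} {f : ℝ → ℕ → ℝ}
    (hf : IsMildSolutionOn K r f (Set.Ico 0 T)) {s t : ℝ} (hs : 0 ≤ s) (hst : s ≤ t) (htT : t < T)
    (m : ℕ) :
    f t (m + 1) - f s (m + 1) = ∫ u in s..t, (exchangeRate K (f u) (m + 2)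
      - 2 * exchangeRate K (f u) (m + 1) + exchangeRate K (f u) m) := by
  have h0 : ∀ v, 0 ≤ v → v < T → f v (m + 1) = f 0 (m + 1) + ∫ u in (0 : ℝ)..v,
      (exchangeRate K (f u) (m + 2) - 2 * exchangeRate K (f u) (m + 1)
        + exchangeRate K (f u) m) := by
    intro v hv hvT
    rw [hf.2.2.2.2.2.2 v ⟨hv, hvT⟩ m]
    congr 1
    refine intervalIntegral.integral_congr fun u hu => ?_
    rw [Set.uIcc_of_le hv] at hu
    have hsum := hf.2.2.2.1 u ⟨hu.1, hu.2.trans_lt hvT⟩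
    simp only [tsum_kernel_succ hC1 hKsym hKge hKle (hsum _), exchangeRate]
    ring
  have hint : ∀ v w, 0 ≤ v → v ≤ w → w < T → IntervalIntegrable (fun u =>
      exchangeRate K (f u) (m + 2) - 2 * exchangeRate K (f u) (m + 1)
        + exchangeRate K (f u) m) volume v w := fun v w hv hvw hw =>
    (((hf.intervalIntegrable_exchangeRate hv hvw hw _).sub
      ((hf.intervalIntegrable_exchangeRate hv hvw hw _).const_mul 2)).add
        (hf.intervalIntegrable_exchangeRate hv hvw hw _))
  rw [h0 t (hs.trans hst) htT, h0 s hs (hst.trans_lt htT), add_sub_add_left_eq_sub,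
    intervalIntegral.integral_interval_sub_left (hint 0 t le_rfl (hs.trans hst) htT)
      (hint 0 s le_rfl hs (hst.trans_lt htT))]

theorem IsMildSolutionOn.partialMom_add_integral_le_mom (hα : 1 < α) (hα2 : α ≤ 2) (hC : 0 < C)
    (hC1 : 0 < C1) (hKsym : ∀ j k : ℕ, K j k = K k j)
    (hKge : ∀ j k : ℕ, C1 * ((j : ℝ) ^ 2 * (k : ℝ) ^ α + (j : ℝ) ^ α * (k : ℝ) ^ 2) ≤ K j k)
    (hKle : ∀ j k : ℕ, K j k ≤ C * (j : ℝ) ^ 2 * (k : ℝ) ^ 2) {T : ℝ} {f : ℝ → ℕ → ℝ}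
    (hf : IsMildSolutionOn K 2 f (Set.Ico 0 T)) {s t : ℝ} (hs : 0 ≤ s) (hst : s ≤ t) (htT : t < T)
    (hmass : mom 1 (f t) = mom 1 (f s)) (n : ℕ) :
    partialMom α n (f s) + α * (α - 1) / 2 * C1 * ∫ u in s..t, partialMom α n (f u) ^ 2
      ≤ mom α (f t) := by
  obtain ⟨B, hB⟩ := hf.2.2.1
  have hsub : Set.Icc s t ⊆ Set.Ico 0 T := fun u hu => ⟨hs.trans hu.1, hu.2.trans_lt htT⟩
  have hB' : ∀ u ∈ Set.Icc s t, mom 2 (f u) ≤ |B| + 1 := fun u hu =>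
    (hB u (hsub hu)).trans (by linarith [le_abs_self B])
  have hY : ∀ u ∈ Set.Icc s t, MemYplus 2 (f u) := fun u hu => hf.1 u (hsub hu)
  have hsum := fun u (hu : u ∈ Set.Icc s t) => hf.2.2.2.1 u (hsub hu)
  refine _root_.partialMom_add_integral_le_mom (D := C * (|B| + 1)) (B := |B| + 1)
    (G := fun u => exchangeRate K (f u)) hα hα2 hC1.le (by positivity) hst hY
    (fun j => (hf.2.1 j).mono hsub) hB' hmass
    (hf.intervalIntegrable_exchangeRate hs hst htT) (fun u => ?_)
    (hf.sub_eq_integral hC1 hKsym hKge hKle hs hst htT) (fun u hu j => ?_)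
    (fun u hu j n => le_exchangeRate hC1 hKge (hY u hu).1 (hsum u hu j) n)
    (fun u hu j => exchangeRate_le hC hKle (hY u hu) (hB' u hu) (hsum u hu j)) n
  · simp [exchangeRate, kernel_zero_left hC1 hKge hKle]
  · exact mul_nonneg ((hY u hu).1 j)
      (tsum_nonneg fun k => mul_nonneg (kernel_nonneg hC1 hKge j k) ((hY u hu).1 k))

end Kernel

/-- Corollary 2.8: non-existence of global mass-conserving solutions in
`Y_2^+`. -/
theorem edg_no_global_mass_conserving (α C C1 : ℝ) (K : ℕ → ℕ → ℝ) (f0 : ℕ → ℝ)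
    (hα : 1 < α) (hα2 : α ≤ 2) (hC : 0 < C) (hC1 : 0 < C1)
    (hKsym : ∀ j k : ℕ, K j k = K k j)
    (hKge : ∀ j k : ℕ, C1 * ((j : ℝ) ^ 2 * (k : ℝ) ^ α + (j : ℝ) ^ α * (k : ℝ) ^ 2) ≤ K j k)
    (hKle : ∀ j k : ℕ, K j k ≤ C * (j : ℝ) ^ 2 * (k : ℝ) ^ 2)
    (hf0 : MemYplus (2 + α) f0) (hMα : 0 < mom α f0) :
    ¬ ∃ f : ℝ → ℕ → ℝ, f 0 = f0 ∧
        (∀ T : ℝ, 0 < T → IsMildSolutionOn K 2 f (Set.Ico 0 T)) ∧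
        (∀ t : ℝ, 0 ≤ t → MemYplus 2 (f t)) ∧
        (∀ t : ℝ, 0 ≤ t → mom 1 (f t) = mom 1 f0) := by
  rintro ⟨f, hf0', hmild, hY, hmass⟩
  have hc : 0 < α * (α - 1) / 2 * C1 := by
    have : 0 < α - 1 := by linarith
    positivity
  have hcont : ∀ j, ContinuousOn (fun t => f t j) (Set.Ici 0) := fun j t ht => by
    have h := (hmild (t + 1) (by linarith [Set.mem_Ici.1 ht])).2.1 j t ⟨ht, by linarith⟩
    refine h.mono_of_mem_nhdsWithin ?_
    rw [← Set.Ici_inter_Iio]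
    exact inter_mem_nhdsWithin _ (Iio_mem_nhds (by linarith))
  have hgrowth : ∀ s t, 0 ≤ s → s ≤ t →
      mom α (f s) + α * (α - 1) / 2 * C1 * ((t - s) * mom α (f s) ^ 2) ≤ mom α (f t) :=
    fun s t hs hst => mom_add_mul_sq_le hα hc (fun u hu => (hY u hu).1)
      (fun u hu => (hY u hu).summable_of_le (by linarith) hα2) hcont
      (fun s t hs hst n => (hmild (t + 1) (by linarith)).partialMom_add_integral_le_mom hα hα2 hC
        hC1 hKsym hKge hKle hs hst (by linarith)
        ((hmass t (hs.trans hst)).trans (hmass s hs).symm) n) hs hst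
  have hM0 : 0 < mom α (f 0) := by rwa [hf0']
  obtain ⟨B, hB⟩ := (hmild (2 / (α * (α - 1) / 2 * C1 * mom α (f 0))) (by positivity)).2.2.1
  obtain ⟨t, ht, hBt⟩ := exists_lt_of_add_mul_sq_le (M := fun t => mom α (f t)) hc hM0 hgrowth B
  exact absurd (((hY t ht.1).mom_le (by linarith) hα2).trans (hB t ht)) (not_le.2 hBt)
end
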